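/- arXiv:2008.01385 — 2 statements merged into one kernel-verified Lean document; each statement's English description precedes it below -/
import Mathlib

section
/- There exists γ*(d) > √(7d/4) such that for every γ ∈ (0, γ*(d)] and every Borel set A ⊆ D, the family {M^H_γ(A)}_{H∈(0,H₀)} is Cauchy in L¹(P) as H ↓ 0; consequently M^H_γ(A) converges in L¹(P), and hence in probability, to a limit random variable M_γ(A) as H ↓ 0. -/
open MeasureTheory ProbabilityTheory Filter Set

/-- A linear space of centered real Gaussian random variables. -/
def IsCenteredGaussianSpace {Ω : Type*} [MeasurableSpace Ω] (P : Measure Ω)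
    (S : Submodule ℝ (Ω → ℝ)) : Prop :=
  ∀ f ∈ S, Measurable f ∧ ∃ v : NNReal, P.map f = gaussianReal 0 v

namespace IsCenteredGaussianSpace

variable {Ω : Type*} [MeasurableSpace Ω] {P : Measure Ω}
  {S : Submodule ℝ (Ω → ℝ)}

lemma memLp_two (hS : IsCenteredGaussianSpace P S) {f : Ω → ℝ} (hf : f ∈ S) : MemLp f 2 P := by
  obtain ⟨hm, v, hv⟩ := hS f hf
  have h : MemLp id 2 (P.map f) := by
    rw [hv]; exact memLp_id_gaussianReal' 2 (by simp)
  exact (memLp_map_measure_iff (by fun_prop) hm.aemeasurable).1 h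

lemma integrable_mul (hS : IsCenteredGaussianSpace P S) {f g : Ω → ℝ} (hf : f ∈ S) (hg : g ∈ S) :
    Integrable (fun ω => f ω * g ω) P :=
  (hS.memLp_two hf).integrable_mul (hS.memLp_two hg)

lemma integrable_exp (hS : IsCenteredGaussianSpace P S) {f : Ω → ℝ} (hf : f ∈ S) :
    Integrable (fun ω => Real.exp (f ω)) P := by
  obtain ⟨hm, v, hv⟩ := hS f hf
  have h := integrable_exp_mul_gaussianReal (μ := 0) (v := v) 1
  rw [← hv, integrable_map_measure (by fun_prop) hm.aemeasurable] at h
  simpa [Function.comp_def] using h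

lemma integral_exp (hS : IsCenteredGaussianSpace P S) {f : Ω → ℝ} (hf : f ∈ S) :
    ∫ ω, Real.exp (f ω) ∂P = Real.exp ((∫ ω, f ω * f ω ∂P) / 2) := by
  obtain ⟨hm, v, hv⟩ := hS f hf
  have h1 := mgf_gaussianReal hv 1
  have h2 : ∫ ω, f ω * f ω ∂P = v := by
    have h3 : ∫ x, x * x ∂(P.map f) = v := by
      rw [hv]
      have h4 := variance_fun_id_gaussianReal (μ := 0) (v := v)
      rw [variance_of_integral_eq_zero (by fun_prop) integral_id_gaussianReal] at h4
      simpa [pow_two] using h4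
    rwa [integral_map hm.aemeasurable (by fun_prop)] at h3
  rw [h2]
  simpa [mgf] using h1

lemma integral_add_mul (hS : IsCenteredGaussianSpace P S) {f g h : Ω → ℝ} (hf : f ∈ S)
    (hg : g ∈ S) (hh : h ∈ S) :
    ∫ ω, (f + g) ω * h ω ∂P = ∫ ω, f ω * h ω ∂P + ∫ ω, g ω * h ω ∂P := by
  rw [← integral_add (hS.integrable_mul hf hh) (hS.integrable_mul hg hh)]
  simp [add_mul]

lemma integral_smul_mul (c : ℝ) (f h : Ω → ℝ) :
    ∫ ω, (c • f) ω * h ω ∂P = c * ∫ ω, f ω * h ω ∂P := by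
  rw [← integral_const_mul]; simp [mul_assoc]

lemma integral_sum_smul_mul (hS : IsCenteredGaussianSpace P S) {ι : Type*} (s : Finset ι)
    (c : ι → ℝ) (V : ι → Ω → ℝ) (hV : ∀ i ∈ s, V i ∈ S) {h : Ω → ℝ} (hh : h ∈ S) :
    ∫ ω, (∑ i ∈ s, c i • V i) ω * h ω ∂P = ∑ i ∈ s, c i * ∫ ω, V i ω * h ω ∂P := by
  simp only [Finset.sum_apply, Pi.smul_apply, smul_eq_mul, Finset.sum_mul]
  rw [integral_finsetSum _ fun i hi => by
    simpa [mul_assoc] using (hS.integrable_mul (hV i hi) hh).const_mul (c i)]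
  simp [mul_assoc, integral_const_mul]

lemma integral_mul_symm (f g : Ω → ℝ) : ∫ ω, f ω * g ω ∂P = ∫ ω, g ω * f ω ∂P := by
  simp [mul_comm]

/-- Expansion of the Gaussian exponential moment of a combination of two variables. -/
lemma integral_exp_add_smul (hS : IsCenteredGaussianSpace P S) {Z f : Ω → ℝ} (hZ : Z ∈ S)
    (hf : f ∈ S) (s : ℝ) :
    ∫ ω, Real.exp (Z ω + s * f ω) ∂P = Real.exp ((∫ ω, Z ω * Z ω ∂P) / 2) *
      Real.exp (s * (∫ ω, Z ω * f ω ∂P) + s ^ 2 * (∫ ω, f ω * f ω ∂P) / 2) := by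
  have hsf : s • f ∈ S := S.smul_mem s hf
  have h := hS.integral_exp (S.add_mem hZ hsf)
  rw [hS.integral_add_mul hZ hsf (S.add_mem hZ hsf), integral_mul_symm Z, integral_mul_symm (s • f),
    hS.integral_add_mul hZ hsf hZ, hS.integral_add_mul hZ hsf hsf, integral_mul_symm Z (s • f),
    integral_smul_mul, integral_smul_mul, integral_mul_symm f (s • f), integral_smul_mul,
    integral_mul_symm f Z] at h
  simp only [Pi.add_apply, Pi.smul_apply, smul_eq_mul] at h
  rw [h, ← Real.exp_add]
  congr 1
  ring

/-- Under the exponential tilt by `Z`, the characteristic function of `f` is that of the shifted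
variable `f + E[Z f]`. -/
lemma integral_cexp_tilted [IsProbabilityMeasure P] (hS : IsCenteredGaussianSpace P S)
    {Z f : Ω → ℝ} (hZ : Z ∈ S)
    (hf : f ∈ S) :
    ∫ ω, Complex.exp (f ω * Complex.I) ∂(P.tilted Z) =
      ∫ ω, Complex.exp ((f ω + ∫ ω', Z ω' * f ω' ∂P : ℝ) * Complex.I) ∂P := by
  have hfm := (hS f hf).1
  have : IsProbabilityMeasure (P.tilted Z) := isProbabilityMeasure_tilted (hS.integrable_exp hZ)
  set m := ∫ ω', Z ω' * f ω' ∂P with hm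
  have hmgf : mgf f (P.tilted Z) = mgf (fun ω => f ω + m) P := by
    funext s
    rw [mgf, integral_exp_tilted, mgf, hS.integral_exp hZ]
    have h1 := hS.integral_exp_add_smul hZ hf s
    have h2 := hS.integral_exp (S.smul_mem s hf)
    rw [integral_smul_mul, integral_mul_symm, integral_smul_mul] at h2
    simp only [Pi.add_apply]
    rw [h1, mul_div_cancel_left₀ _ (Real.exp_pos _).ne', ← hm]
    simp only [mul_add, Real.exp_add, integral_mul_const]
    simp only [Pi.smul_apply, smul_eq_mul] at h2
    rw [h2, ← Real.exp_add, ← Real.exp_add]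
    congr 1
    ring
  have hset : integrableExpSet f (P.tilted Z) = univ := by
    rw [integrableExpSet_eq_of_mgf hmgf]
    ext s
    simp only [integrableExpSet, mem_ofPred_eq, mem_univ, iff_true, mul_add, Real.exp_add]
    exact (by simpa using hS.integrable_exp (S.smul_mem s hf) :
      Integrable (fun ω => Real.exp (s * f ω)) P).mul_const _
  have h := eqOn_complexMGF_of_mgf hmgf (x := Complex.I) (by simp [hset])
  simpa [complexMGF, mul_comm] using h

/-- Cameron-Martin formula for finitely many variables of a Gaussian space. -/
lemma integral_exp_mul_comp [IsProbabilityMeasure P] (hS : IsCenteredGaussianSpace P S)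
    {ι : Type*} [Fintype ι]
    {V : ι → Ω → ℝ} (hV : ∀ i, V i ∈ S) {Z : Ω → ℝ} (hZ : Z ∈ S) {Φ : (ι → ℝ) → ℝ}
    (hΦ : Measurable Φ) :
    ∫ ω, Real.exp (Z ω - (∫ ω', Z ω' * Z ω' ∂P) / 2) * Φ (fun i => V i ω) ∂P =
      ∫ ω, Φ (fun i => V i ω + ∫ ω', Z ω' * V i ω' ∂P) ∂P := by
  classical
  have : IsProbabilityMeasure (P.tilted Z) := isProbabilityMeasure_tilted (hS.integrable_exp hZ)
  have hVm : ∀ i, Measurable (V i) := fun i => (hS _ (hV i)).1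
  have hVm' : Measurable fun ω i => V i ω := by fun_prop
  have hVm'' : Measurable fun ω i => V i ω + ∫ ω', Z ω' * V i ω' ∂P := by fun_prop
  have hlaw : (P.tilted Z).map (fun ω i => V i ω) =
      P.map (fun ω i => V i ω + ∫ ω', Z ω' * V i ω' ∂P) := by
    have := Measure.isProbabilityMeasure_map (μ := P.tilted Z) hVm'.aemeasurable
    have := Measure.isProbabilityMeasure_map (μ := P) hVm''.aemeasurable
    refine Measure.ext_of_charFunDual (funext fun L => ?_)
    rw [charFunDual_apply, charFunDual_apply, integral_map (by fun_prop) (by fun_prop),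
      integral_map (by fun_prop) (by fun_prop)]
    have hL : ∀ y : ι → ℝ, L y = ∑ i, L (Pi.single i 1) * y i := by
      intro y
      conv_lhs => rw [← Finset.univ_sum_single y]
      rw [map_sum]
      refine Finset.sum_congr rfl fun i _ => ?_
      have : (Pi.single i (y i) : ι → ℝ) = y i • Pi.single i 1 := by
        rw [← Pi.single_smul]; simp
      rw [this, map_smul, smul_eq_mul, mul_comm]
    have hf : ∑ i, L (Pi.single i 1) • V i ∈ S :=
      S.sum_mem fun i _ => S.smul_mem _ (hV i)
    have h := hS.integral_cexp_tilted hZ hf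
    have hB : ∫ ω, Z ω * (∑ i, L (Pi.single i 1) • V i) ω ∂P =
        ∑ i, L (Pi.single i 1) * ∫ ω, Z ω * V i ω ∂P := by
      rw [integral_mul_symm, hS.integral_sum_smul_mul _ _ _ (fun i _ => hV i) hZ]
      simp only [mul_comm (Z _)]
    rw [hB] at h
    simp only [hL (fun i => V i _ + _), hL (fun i => V i _)]
    simpa [mul_add, Finset.sum_add_distrib] using h
  have h1 : ∫ y, Φ y ∂_ = ∫ y, Φ y ∂_ := congrArg (fun μ => ∫ y, Φ y ∂μ) hlaw
  rw [integral_map hVm'.aemeasurable hΦ.aestronglyMeasurable,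
    integral_map hVm''.aemeasurable hΦ.aestronglyMeasurable, integral_tilted] at h1
  rw [← h1]
  refine integral_congr_ae (.of_forall fun ω => ?_)
  simp only [smul_eq_mul, hS.integral_exp hZ, Real.exp_sub]

end IsCenteredGaussianSpace

/-- The regularised negative logarithm `(1 - s ^ p) / p`, which tends to `-log s` as `p → 0`. -/
noncomputable def regNegLog (p s : ℝ) : ℝ := (1 - s ^ p) / p

lemma regNegLog_le_neg_log {p s : ℝ} (hp : 0 < p) (hs : 0 < s) : regNegLog p s ≤ -Real.log s := by
  rw [regNegLog, div_le_iff₀ hp, Real.rpow_def_of_pos hs]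
  have := Real.add_one_le_exp (Real.log s * p)
  linarith

lemma one_sub_le_regNegLog {p s : ℝ} (hp : 0 < p) (hp1 : p ≤ 1) (hs : 0 ≤ s) :
    1 - s ≤ regNegLog p s := by
  rw [regNegLog, le_div_iff₀ hp]
  have := rpow_one_add_le_one_add_mul_self (s := s - 1) (by linarith) hp.le hp1
  rw [add_sub_cancel] at this
  linarith

lemma regNegLog_anti {p s t : ℝ} (hp : 0 < p) (hs : 0 ≤ s) (hst : s ≤ t) :
    regNegLog p t ≤ regNegLog p s := by
  unfold regNegLog
  have := Real.rpow_le_rpow hs hst hp.le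
  gcongr

lemma regNegLog_sub_one_le {p r : ℝ} (hp : 0 < p) (hp1 : p ≤ 1) (hr : 0 ≤ r) (hr1 : r ≤ 1) :
    regNegLog p r - 1 ≤ regNegLog p (2 * r) := by
  unfold regNegLog
  rw [div_sub_one hp.ne', div_le_div_iff_of_pos_right hp, Real.mul_rpow (by norm_num) hr]
  have h1 := rpow_one_add_le_one_add_mul_self (s := 1) (by norm_num) hp.le hp1
  norm_num at h1
  have h2 : r ^ p ≤ 1 := Real.rpow_le_one hr hr1 hp.le
  have h3 : 0 ≤ r ^ p := Real.rpow_nonneg hr p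
  nlinarith

lemma abs_regNegLog_add_log_le {p s : ℝ} (hp : 0 < p) (hs : 0 < s) (h : p * |Real.log s| ≤ 1) :
    |regNegLog p s + Real.log s| ≤ p * Real.log s ^ 2 := by
  have h1 : |Real.log s * p| ≤ 1 := by rw [abs_mul, abs_of_pos hp, mul_comm]; exact h
  have h2 := Real.abs_exp_sub_one_sub_id_le h1
  have h3 : regNegLog p s + Real.log s = -(Real.exp (Real.log s * p) - 1 - Real.log s * p) / p := by
    rw [regNegLog, Real.rpow_def_of_pos hs]; field_simp; ring
  rw [h3, abs_div, abs_neg, abs_of_pos hp, div_le_iff₀ hp]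
  calc _ ≤ _ := h2
    _ = _ := by ring

lemma regNegLog_exp_neg (p L : ℝ) :
    regNegLog p (Real.exp (-L)) = (1 - Real.exp (-(p * L))) / p := by
  rw [regNegLog, ← Real.exp_mul]; congr 3; ring_nf

lemma regNegLog_exp_neg_nonneg {p L : ℝ} (hp : 0 < p) (hL : 0 ≤ L) :
    0 ≤ regNegLog p (Real.exp (-L)) := by
  rw [regNegLog_exp_neg]
  have : Real.exp (-(p * L)) ≤ 1 := Real.exp_le_one_iff.2 (by nlinarith)
  exact div_nonneg (by linarith) hp.le

lemma regNegLog_exp_neg_le {p L : ℝ} (hp : 0 < p) : regNegLog p (Real.exp (-L)) ≤ L := by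
  simpa using regNegLog_le_neg_log hp (Real.exp_pos (-L))

lemma regNegLog_le_inv {p s : ℝ} (hp : 0 < p) (hs : 0 ≤ s) : regNegLog p s ≤ 1 / p := by
  unfold regNegLog
  have := Real.rpow_nonneg hs p
  gcongr
  linarith

lemma regNegLog_exp_neg_sub_le {p q L : ℝ} (hp : 0 < p) (hq : 0 < q) (hL : 0 < L) :
    regNegLog p (Real.exp (-L)) - q * L ^ 2 ≤ regNegLog (q + p) (Real.exp (-L)) := by
  rw [regNegLog_exp_neg, regNegLog_exp_neg]
  set x := p * L with hx
  set e := q * L with he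
  have hx0 : 0 < x := by positivity
  have he0 : 0 < e := by positivity
  have h1 : Real.exp (-((q + p) * L)) = Real.exp (-x) * Real.exp (-e) := by
    rw [← Real.exp_add]; congr 1; rw [hx, he]; ring
  have h2 : Real.exp (-e) ≤ 1 - e + e ^ 2 / 2 := by
    have h := Real.quadratic_le_exp_of_nonneg he0.le
    rw [Real.exp_neg, inv_le_comm₀ (Real.exp_pos _) (by nlinarith [sq_nonneg (e - 1)])]
    refine le_trans ?_ h
    rw [inv_le_iff_one_le_mul₀ (by nlinarith [sq_nonneg (e - 1)])]
    nlinarith [sq_nonneg (e ^ 2)]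
  have h3 : (1 + x) * (1 - x) ≤ (1 + x) * Real.exp (-x) := by
    gcongr
    linarith [Real.add_one_le_exp (-x)]
  have h4 : Real.exp (-x) ≤ 1 := Real.exp_le_one_iff.2 (by linarith)
  have h5 : (1 - Real.exp (-x)) / x - e ≤ (1 - Real.exp (-x) * Real.exp (-e)) / (x + e) := by
    rw [div_sub' hx0.ne', div_le_div_iff₀ hx0 (by positivity)]
    have h6 : x * Real.exp (-x) * Real.exp (-e) ≤ x * Real.exp (-x) * (1 - e + e ^ 2 / 2) := by
      gcongr
    have h7 : x * e ^ 2 * Real.exp (-x) ≤ x * e ^ 2 * 1 := by gcongr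
    nlinarith
  have h8 : (1 - Real.exp (-x)) / p = L * ((1 - Real.exp (-x)) / x) := by
    rw [hx]; field_simp
  have h9 : (1 - Real.exp (-x) * Real.exp (-e)) / (q + p) =
      L * ((1 - Real.exp (-x) * Real.exp (-e)) / (x + e)) := by
    rw [hx, he]; field_simp; ring
  rw [h1, h8, h9]
  nlinarith [mul_le_mul_of_nonneg_left h5 hL.le]

/-- The tilt parameter `t` gains at least half of the logarithm in the second moment exponent. -/
lemma exists_tilt {p L : ℝ} (hp : 0 < p) (hL : 0 < L) :
    ∃ t y : ℝ, 0 ≤ t ∧ t ≤ 1 ∧ 0 ≤ y ∧ y ≤ 1 ∧ regNegLog p (Real.exp (-L)) = L * y ∧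
      regNegLog (p + p) (Real.exp (-L)) + L * (t - 2 * t * y + t ^ 2 / 2) ≤ L / 2 := by
  rw [regNegLog_exp_neg, regNegLog_exp_neg]
  set a := p * L with ha
  have ha0 : 0 < a := by positivity
  set y := (1 - Real.exp (-a)) / a with hy
  have hya : Real.exp (-a) = 1 - a * y := by rw [hy]; field_simp; ring
  have he : Real.exp (-a) ≤ 1 := Real.exp_le_one_iff.2 (by linarith)
  have hy0 : 0 ≤ y := div_nonneg (by linarith) ha0.le
  have hy1 : y ≤ 1 := by
    rw [hy, div_le_one ha0]; linarith [Real.add_one_le_exp (-a)]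
  have hy2 : 1 - a / 2 ≤ y := by
    have h2 : Real.exp (-a) ≤ 1 - a + a ^ 2 / 2 := by
      have h := Real.quadratic_le_exp_of_nonneg ha0.le
      rw [Real.exp_neg, inv_le_comm₀ (Real.exp_pos _) (by nlinarith [sq_nonneg (a - 1)])]
      refine le_trans ?_ h
      rw [inv_le_iff_one_le_mul₀ (by nlinarith [sq_nonneg (a - 1)])]
      nlinarith [sq_nonneg (a ^ 2)]
    rw [hy, le_div_iff₀ ha0]; nlinarith
  have h1 : (1 - Real.exp (-a)) / p = L * y := by rw [hy, ha]; field_simp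
  have h2 : (1 - Real.exp (-((p + p) * L))) / (p + p) = L * (y - a * y ^ 2 / 2) := by
    have : Real.exp (-((p + p) * L)) = Real.exp (-a) * Real.exp (-a) := by
      rw [← Real.exp_add]; congr 1; rw [ha]; ring
    rw [this, hya, ha]; field_simp; ring
  rcases le_total (1 / 2) y with h | h
  · refine ⟨2 * y - 1, y, by linarith, by linarith, hy0, hy1, h1, ?_⟩
    rw [h2, ← mul_add, div_eq_mul_one_div L]
    refine mul_le_mul_of_nonneg_left ?_ hL.le
    nlinarith [pow_nonneg (sub_nonneg.2 hy1) 3,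
      mul_le_mul_of_nonneg_right hy2 (sq_nonneg y)]
  · refine ⟨0, y, le_rfl, by norm_num, hy0, hy1, h1, ?_⟩
    rw [h2, ← mul_add, div_eq_mul_one_div L]
    refine mul_le_mul_of_nonneg_left ?_ hL.le
    nlinarith [mul_nonneg ha0.le (sq_nonneg y)]

/-- The linear span of the variables `X H x` with `H ∈ (0, η)` and `x ∈ D`. -/
def fieldSpan {Ω E : Type*} (X : ℝ → E → Ω → ℝ) (D : Set E) (η : ℝ) : Submodule ℝ (Ω → ℝ) :=
  Submodule.span ℝ {f | ∃ H ∈ Ioo 0 η, ∃ x ∈ D, f = X H x}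

/-- Gaussian fields whose covariances approximate `-log ‖x - y‖ + g x y`, with uniform bounds in
terms of the regularised logarithm, up to a multiplicative error `δ` and an additive error `K`. -/
structure IsLogField {Ω E : Type*} [MeasurableSpace Ω] [NormedAddCommGroup E] (P : Measure Ω)
    (D : Set E) (X : ℝ → E → Ω → ℝ) (g : E → E → ℝ) (η δ K : ℝ) : Prop where
  pos : 0 < η
  le_half : η ≤ 1 / 2
  delta_pos : 0 < δ
  delta_lt : δ < 1
  const_nonneg : 0 ≤ K
  gaussian : IsCenteredGaussianSpace P (fieldSpan X D η)
  cov_le : ∀ H ∈ Ioo 0 η, ∀ h ∈ Ioo 0 η, ∀ x ∈ D, ∀ y ∈ D,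
    ∫ ω, X H x ω * X h y ω ∂P ≤ (1 + δ) * max (regNegLog (H + h) ‖x - y‖) 0 + K
  le_cov : ∀ H ∈ Ioo 0 η, ∀ h ∈ Ioo 0 η, ∀ x ∈ D, ∀ y ∈ D,
    (1 - δ) * regNegLog (H + h) ‖x - y‖ - K ≤ ∫ ω, X H x ω * X h y ω ∂P
  cov_tendsto : ∀ s > 0, ∀ τ > 0, ∃ η' > 0, ∀ H ∈ Ioo 0 η, ∀ h ∈ Ioo 0 η, H < η' → h < η' →
    ∀ x ∈ D, ∀ y ∈ D, s ≤ ‖x - y‖ →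
      |∫ ω, X H x ω * X h y ω ∂P - (-Real.log ‖x - y‖ + g x y)| ≤ τ

lemma isCenteredGaussianSpace_fieldSpan {Ω E : Type*} [MeasurableSpace Ω] {P : Measure Ω}
    {X : ℝ → E → Ω → ℝ} {D : Set E} {η : ℝ} (hmeas : ∀ H x, Measurable (X H x))
    (hgauss : ∀ (n : ℕ) (c : Fin n → ℝ) (Hs : Fin n → ℝ) (xs : Fin n → E),
      (∀ i, Hs i ∈ Ioo 0 η) → (∀ i, xs i ∈ D) →
      ∃ v : NNReal, P.map (fun ω => ∑ i, c i * X (Hs i) (xs i) ω) = gaussianReal 0 v) :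
    IsCenteredGaussianSpace P (fieldSpan X D η) := by
  intro f hf
  obtain ⟨n, c, gs, rfl⟩ := Submodule.mem_span_set'.1 hf
  choose Hs hHs xs hxs hg using fun i => (gs i).2
  have h : ∑ i, c i • (gs i : Ω → ℝ) = fun ω => ∑ i, c i * X (Hs i) (xs i) ω := by
    funext ω
    simp [Finset.sum_apply, hg]
  rw [h]
  exact ⟨Finset.measurable_sum _ fun i _ => (hmeas _ _).const_mul _,
    hgauss n c Hs xs hHs hxs⟩

lemma isLogField_of_cov {Ω E : Type*} [MeasurableSpace Ω] {P : Measure Ω}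
    [NormedAddCommGroup E] {D : Set E} (hD : Bornology.IsBounded D)
    {H₀ : ℝ} (hH₀ : H₀ ∈ Ioo (0 : ℝ) (1 / 2))
    {X : ℝ → E → Ω → ℝ} {C : ℝ → ℝ → ℝ} {G : ℝ → ℝ → E → E → ℝ} {g : E → E → ℝ}
    (hmeas : ∀ H x, Measurable (X H x))
    (hgauss : ∀ (n : ℕ) (c : Fin n → ℝ) (Hs : Fin n → ℝ) (xs : Fin n → E),
      (∀ i, Hs i ∈ Ioo 0 H₀) → (∀ i, xs i ∈ D) →
      ∃ v : NNReal, P.map (fun ω => ∑ i, c i * X (Hs i) (xs i) ω) = gaussianReal 0 v)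
    (hcov : ∀ H h : ℝ, H ∈ Ioo 0 H₀ → h ∈ Ioo 0 H₀ → ∀ x ∈ D, ∀ y ∈ D,
      ∫ ω, X H x ω * X h y ω ∂P =
        C H h * ((1 - ‖x - y‖ ^ (H + h)) / (H + h) + G H h x y))
    (hA1 : ∀ ε > (0 : ℝ), ∃ η > (0 : ℝ), ∀ H h : ℝ,
      H ∈ Ioo 0 (min η H₀) → h ∈ Ioo 0 (min η H₀) → |C H h - 1| ≤ ε)
    (hgbdd : ∃ K : ℝ, ∀ x ∈ D, ∀ y ∈ D, |g x y| ≤ K)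
    (hA2 : ∀ ε > (0 : ℝ), ∃ η > (0 : ℝ), ∀ H h : ℝ,
      H ∈ Ioo 0 (min η H₀) → h ∈ Ioo 0 (min η H₀) →
      ∀ x ∈ D, ∀ y ∈ D, |G H h x y - g x y| ≤ ε)
    {δ : ℝ} (hδ : 0 < δ) (hδ1 : δ < 1) :
    ∃ η K : ℝ, η ≤ H₀ ∧ IsLogField P D X g η δ K := by
  obtain ⟨η₁, hη₁, hC⟩ := hA1 δ hδ
  obtain ⟨η₂, hη₂, hG⟩ := hA2 1 one_pos
  obtain ⟨K₀, hK₀⟩ := hgbdd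
  obtain ⟨R, hR0, hR⟩ : ∃ R : ℝ, 1 ≤ R ∧ ∀ x ∈ D, ∀ y ∈ D, ‖x - y‖ ≤ R := by
    refine ⟨max 1 (Metric.diam D), le_max_left _ _, fun x hx y hy => ?_⟩
    rw [← dist_eq_norm]
    exact (Metric.dist_le_diam_of_mem hD hx hy).trans (le_max_right _ _)
  set K₁ := |K₀| + 1
  have hK₁ : 0 < K₁ := by positivity
  set η := min (min η₁ η₂) H₀
  have hηpos : 0 < η := lt_min (lt_min hη₁ hη₂) hH₀.1
  have hsub : ∀ H ∈ Ioo 0 η, H ∈ Ioo 0 (min η₁ H₀) ∧ H ∈ Ioo 0 (min η₂ H₀) ∧ H ∈ Ioo 0 H₀ := by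
    intro H hH
    obtain ⟨h1, h2⟩ := lt_min_iff.1 hH.2
    obtain ⟨h3, h4⟩ := lt_min_iff.1 h1
    exact ⟨⟨hH.1, lt_min h3 h2⟩, ⟨hH.1, lt_min h4 h2⟩, hH.1, h2⟩
  have hGK : ∀ H ∈ Ioo 0 η, ∀ h ∈ Ioo 0 η, ∀ x ∈ D, ∀ y ∈ D, |G H h x y| ≤ K₁ := by
    intro H hH h hh x hx y hy
    have h1 := hG H h (hsub H hH).2.1 (hsub h hh).2.1 x hx y hy
    have h2 := (hK₀ x hx y hy).trans (le_abs_self K₀)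
    calc |G H h x y| = |(G H h x y - g x y) + g x y| := by congr 1; ring
      _ ≤ _ := abs_add_le _ _
      _ ≤ K₁ := by linarith
  have hC' : ∀ H ∈ Ioo 0 η, ∀ h ∈ Ioo 0 η, 1 - δ ≤ C H h ∧ C H h ≤ 1 + δ := by
    intro H hH h hh
    have := abs_le.1 (hC H h (hsub H hH).1 (hsub h hh).1)
    constructor <;> linarith
  have hcov' : ∀ H ∈ Ioo 0 η, ∀ h ∈ Ioo 0 η, ∀ x ∈ D, ∀ y ∈ D,
      ∫ ω, X H x ω * X h y ω ∂P = C H h * (regNegLog (H + h) ‖x - y‖ + G H h x y) := by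
    intro H hH h hh x hx y hy
    exact hcov H h (hsub H hH).2.2 (hsub h hh).2.2 x hx y hy
  have hCG : ∀ H ∈ Ioo 0 η, ∀ h ∈ Ioo 0 η, ∀ x ∈ D, ∀ y ∈ D, |C H h * G H h x y| ≤ 2 * K₁ := by
    intro H hH h hh x hx y hy
    rw [abs_mul]
    have := hC' H hH h hh
    refine mul_le_mul ?_ (hGK H hH h hh x hx y hy) (abs_nonneg _) (by norm_num)
    rw [abs_le]; constructor <;> linarith
  refine ⟨η, 2 * K₁ + 2 * R, min_le_right _ _, hηpos, (min_le_right _ _).trans hH₀.2.le, hδ, hδ1,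
    by positivity, isCenteredGaussianSpace_fieldSpan hmeas fun n c Hs xs hHs hxs =>
      hgauss n c Hs xs (fun i => (hsub _ (hHs i)).2.2) hxs, ?_, ?_, ?_⟩
  · intro H hH h hh x hx y hy
    rw [hcov' H hH h hh x hx y hy, mul_add]
    have h1 := hC' H hH h hh
    have h2 := (abs_le.1 (hCG H hH h hh x hx y hy)).2
    have h3 : C H h * regNegLog (H + h) ‖x - y‖ ≤ (1 + δ) * max (regNegLog (H + h) ‖x - y‖) 0 :=
      (mul_le_mul_of_nonneg_left (le_max_left _ 0) (by linarith)).trans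
        (mul_le_mul_of_nonneg_right h1.2 (le_max_right _ _))
    linarith
  · intro H hH h hh x hx y hy
    rw [hcov' H hH h hh x hx y hy, mul_add]
    have h1 := hC' H hH h hh
    have h2 := (abs_le.1 (hCG H hH h hh x hx y hy)).1
    have hH1 : H < 1 / 2 := (hsub H hH).2.2.2.trans hH₀.2
    have hh1 : h < 1 / 2 := (hsub h hh).2.2.2.trans hH₀.2
    have h3 := one_sub_le_regNegLog (p := H + h) (by linarith [hH.1, hh.1]) (by linarith)
      (norm_nonneg (x - y))
    have h4 := hR x hx y hy
    have h5 : 0 ≤ (C H h - (1 - δ)) * (regNegLog (H + h) ‖x - y‖ + R) :=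
      mul_nonneg (by linarith) (by linarith)
    have h6 : (C H h - (1 - δ)) * R ≤ 2 * R :=
      mul_le_mul_of_nonneg_right (by linarith) (by linarith)
    linarith
  · intro s hs τ hτ
    set B := max |Real.log s| |Real.log R| + 1
    have hB : 0 < B := by positivity
    obtain ⟨η₃, hη₃, hC₃⟩ := hA1 (min 1 (τ / (3 * (2 * B + K₁)))) (lt_min one_pos (by positivity))
    obtain ⟨η₄, hη₄, hG₄⟩ := hA2 (τ / 3) (by positivity)
    refine ⟨min (min η₃ η₄) (min (1 / (2 * B)) (τ / (6 * B ^ 2))), by positivity, ?_⟩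
    intro H hH h hh hH' hh' x hx y hy hxy
    simp only [lt_min_iff] at hH' hh'
    obtain ⟨⟨a1, a2⟩, a3, a4⟩ := hH'
    obtain ⟨⟨b1, b2⟩, b3, b4⟩ := hh'
    have hHH := (hsub H hH).2.2.2
    have hhH := (hsub h hh).2.2.2
    have c1 := hC₃ H h ⟨hH.1, lt_min a1 hHH⟩ ⟨hh.1, lt_min b1 hhH⟩
    have c2 := hG₄ H h ⟨hH.1, lt_min a2 hHH⟩ ⟨hh.1, lt_min b2 hhH⟩ x hx y hy
    set r := ‖x - y‖
    have hr : 0 < r := hs.trans_le hxy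
    have hlog : |Real.log r| ≤ B := by
      have e1 := Real.log_le_log hs hxy
      have e2 := Real.log_le_log hr (hR x hx y hy)
      have e3 := neg_abs_le (Real.log s)
      have e4 := le_abs_self (Real.log R)
      have e5 := le_max_left |Real.log s| |Real.log R|
      have e6 := le_max_right |Real.log s| |Real.log R|
      rw [abs_le]; constructor <;> linarith
    have hp : 0 < H + h := by linarith [hH.1, hh.1]
    have hpB : (H + h) * B ≤ 1 := by
      have : (H + h) ≤ 1 / B := by
        have : 1 / B = 1 / (2 * B) + 1 / (2 * B) := by field_simp; norm_num
        linarith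
      rwa [le_div_iff₀ hB] at this
    have hpB2 : (H + h) * B ^ 2 ≤ τ / 3 := by
      have : (H + h) ≤ (τ / 3) / B ^ 2 := by
        have : (τ / 3) / B ^ 2 = τ / (6 * B ^ 2) + τ / (6 * B ^ 2) := by field_simp; norm_num
        linarith
      rwa [le_div_iff₀ (by positivity)] at this
    have c3 := abs_regNegLog_add_log_le hp hr
      ((mul_le_mul_of_nonneg_left hlog hp.le).trans hpB)
    have c4 : (H + h) * Real.log r ^ 2 ≤ τ / 3 := by
      refine (mul_le_mul_of_nonneg_left ?_ hp.le).trans hpB2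
      rw [← sq_abs]; exact pow_le_pow_left₀ (abs_nonneg _) hlog 2
    have c5 : |regNegLog (H + h) r + G H h x y| ≤ 2 * B + K₁ := by
      have c6 : (H + h) * Real.log r ^ 2 ≤ B := by
        rw [← sq_abs]
        calc (H + h) * |Real.log r| ^ 2 ≤ (H + h) * B ^ 2 := by gcongr
          _ = ((H + h) * B) * B := by ring
          _ ≤ 1 * B := by gcongr
          _ = B := one_mul _
      have c7 := hGK H hH h hh x hx y hy
      calc |regNegLog (H + h) r + G H h x y|
          = |(regNegLog (H + h) r + Real.log r) - Real.log r + G H h x y| := by congr 1; ring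
        _ ≤ |(regNegLog (H + h) r + Real.log r)| + |Real.log r| + |G H h x y| :=
            (abs_add_le _ _).trans (by gcongr; exact abs_sub _ _)
        _ ≤ _ := by linarith
    rw [hcov' H hH h hh x hx y hy]
    have c8 : |(C H h - 1) * (regNegLog (H + h) r + G H h x y)| ≤ τ / 3 := by
      rw [abs_mul]
      calc _ ≤ τ / (3 * (2 * B + K₁)) * (2 * B + K₁) := by
            gcongr; exact c1.trans (min_le_right _ _)
        _ = τ / 3 := by field_simp
    calc |C H h * (regNegLog (H + h) r + G H h x y) - (-Real.log r + g x y)|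
        = |(C H h - 1) * (regNegLog (H + h) r + G H h x y) + (regNegLog (H + h) r + Real.log r)
            + (G H h x y - g x y)| := by congr 1; ring
      _ ≤ |(C H h - 1) * (regNegLog (H + h) r + G H h x y)| + |regNegLog (H + h) r + Real.log r|
            + |G H h x y - g x y| := (abs_add_le _ _).trans (by gcongr; exact abs_add_le _ _)
      _ ≤ τ := by linarith

/-- `N` equally spaced vectors in direction `e`, at distances between `e⁻ᵏ / 8` and `e⁻ᵏ / 4`. -/
noncomputable def probeOffset {E : Type*} [AddCommGroup E] [Module ℝ E] (e : E) (k N i : ℕ) : E :=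
  (Real.exp (-k) * (N + i + 1) / (8 * N)) • e

/-- The average of `X q` over `N` points near `x` at scale `e⁻ᵏ`. -/
noncomputable def probe {Ω E : Type*} [AddCommGroup E] [Module ℝ E] (X : ℝ → E → Ω → ℝ) (e : E)
    (k N : ℕ) (q : ℝ) (x : E) : Ω → ℝ :=
  ∑ i ∈ Finset.range N, (N : ℝ)⁻¹ • X q (x + probeOffset e k N i)

section Offset

variable {E : Type*} [NormedAddCommGroup E] [NormedSpace ℝ E] {e : E} {k N i j : ℕ}

lemma norm_probeOffset (he : ‖e‖ = 1) :
    ‖probeOffset e k N i‖ = Real.exp (-k) * (N + i + 1) / (8 * N) := by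
  rw [probeOffset, norm_smul, he, mul_one, Real.norm_of_nonneg (by positivity)]

lemma norm_probeOffset_le (he : ‖e‖ = 1) (hi : i < N) :
    ‖probeOffset e k N i‖ ≤ Real.exp (-k) / 4 := by
  have hN : (0 : ℝ) < N := by exact_mod_cast (Nat.zero_le i).trans_lt hi
  have hi' : (i : ℝ) + 1 ≤ N := by exact_mod_cast hi
  rw [norm_probeOffset he, div_le_div_iff₀ (by positivity) (by norm_num)]
  nlinarith [Real.exp_pos (-(k : ℝ))]

lemma le_norm_probeOffset (he : ‖e‖ = 1) (hi : i < N) :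
    Real.exp (-k) / 8 ≤ ‖probeOffset e k N i‖ := by
  have hN : (0 : ℝ) < N := by exact_mod_cast (Nat.zero_le i).trans_lt hi
  rw [norm_probeOffset he, div_le_div_iff₀ (by norm_num) (by positivity)]
  have : (0 : ℝ) ≤ i := i.cast_nonneg
  nlinarith [Real.exp_pos (-(k : ℝ))]

lemma norm_probeOffset_sub (he : ‖e‖ = 1) :
    ‖probeOffset e k N i - probeOffset e k N j‖ =
      Real.exp (-k) * |(i : ℝ) - j| / (8 * N) := by
  have h : probeOffset e k N i - probeOffset e k N j =
      (Real.exp (-k) * ((i : ℝ) - j) / (8 * N)) • e := by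
    rw [probeOffset, probeOffset, ← sub_smul]; congr 1; ring
  rw [h, norm_smul, he, mul_one, Real.norm_eq_abs, abs_div, abs_mul,
    abs_of_pos (Real.exp_pos _), abs_of_nonneg (by positivity : (0 : ℝ) ≤ 8 * N)]

lemma add_probeOffset_mem (he : ‖e‖ = 1) {D : Set E} {x : E} {κ : ℝ} (hx : Metric.ball x κ ⊆ D)
    (hk : Real.exp (-k) ≤ κ) (hi : i < N) : x + probeOffset e k N i ∈ D := by
  apply hx
  rw [Metric.mem_ball, dist_eq_norm, add_sub_cancel_left]
  linarith [norm_probeOffset_le (k := k) he hi, Real.exp_pos (-(k : ℝ))]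

end Offset

lemma sum_log_div_le (N : ℕ) : ∑ m ∈ Finset.range N, Real.log (N / (m + 1)) ≤ N := by
  rcases Nat.eq_zero_or_pos N with rfl | hN
  · simp
  have hN' : (0 : ℝ) < N := by exact_mod_cast hN
  have h1 : ∑ m ∈ Finset.range N, Real.log (N / (m + 1)) =
      Real.log (∏ m ∈ Finset.range N, ((N : ℝ) / (m + 1))) := by
    rw [Real.log_prod fun m _ => by positivity]
  have h2 : ∏ m ∈ Finset.range N, ((N : ℝ) / (m + 1)) = (N : ℝ) ^ N / N.factorial := by
    rw [Finset.prod_div_distrib, Finset.prod_const, Finset.card_range,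
      ← Finset.prod_range_add_one_eq_factorial]
    push_cast
    rfl
  rw [h1, h2, Real.log_le_iff_le_exp (by positivity)]
  exact Real.pow_div_factorial_le_exp _ hN'.le N

lemma sum_log_div_abs_sub_le {N j : ℕ} (hj : j < N) :
    ∑ i ∈ (Finset.range N).erase j, Real.log (N / |(i : ℝ) - j|) ≤ 2 * N := by
  have hnn : ∀ m ∈ Finset.range N, 0 ≤ Real.log ((N : ℝ) / (m + 1)) := fun m hm => by
    have : (m : ℝ) + 1 ≤ N := by exact_mod_cast Finset.mem_range.1 hm
    exact Real.log_nonneg (by rw [le_div_iff₀ (by positivity)]; linarith)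
  have hsplit : Finset.range j ∪ Finset.Ico (j + 1) N = (Finset.range N).erase j := by
    ext i
    simp only [Finset.mem_erase, Finset.mem_range, Finset.mem_union, Finset.mem_Ico]
    omega
  have hdisj : Disjoint (Finset.range j) (Finset.Ico (j + 1) N) := by
    rw [Finset.disjoint_left]; intro i
    simp only [Finset.mem_range, Finset.mem_Ico]; omega
  rw [← hsplit, Finset.sum_union hdisj]
  have h1 : ∑ i ∈ Finset.range j, Real.log (N / |(i : ℝ) - j|) ≤ N := by
    rw [← Finset.sum_range_reflect]
    refine le_trans (le_trans (Finset.sum_le_sum fun i hi => le_of_eq ?_)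
      (Finset.sum_le_sum_of_subset_of_nonneg (Finset.range_mono hj.le) fun m hm _ => hnn m hm))
      (sum_log_div_le N)
    have hi' := Finset.mem_range.1 hi
    have : ((j - 1 - i : ℕ) : ℝ) = j - 1 - i := by
      rw [Nat.cast_sub (by omega), Nat.cast_sub (by omega)]; simp
    rw [this, show (j : ℝ) - 1 - i - j = -(i + 1) by ring, abs_neg, abs_of_pos (by positivity)]
  have h2 : ∑ i ∈ Finset.Ico (j + 1) N, Real.log (N / |(i : ℝ) - j|) ≤ N := by
    rw [Finset.sum_Ico_eq_sum_range]
    refine le_trans (le_trans (Finset.sum_le_sum fun i hi => le_of_eq ?_)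
      (Finset.sum_le_sum_of_subset_of_nonneg
        (Finset.range_mono (by omega : N - (j + 1) ≤ N)) fun m hm _ => hnn m hm))
      (sum_log_div_le N)
    push_cast
    rw [show (j : ℝ) + 1 + i - j = i + 1 by ring, abs_of_pos (by positivity)]
  linarith

lemma average_le {N : ℕ} {a : ℕ → ℝ} {b : ℝ} (hN : 0 < N) (h : ∀ i < N, a i ≤ b) :
    ∑ i ∈ Finset.range N, (N : ℝ)⁻¹ * a i ≤ b := by
  have hN' : (0 : ℝ) < N := by exact_mod_cast hN
  rw [← Finset.mul_sum, inv_mul_le_iff₀ hN']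
  simpa using Finset.sum_le_sum fun i hi => h i (Finset.mem_range.1 hi)

lemma le_average {N : ℕ} {a : ℕ → ℝ} {b : ℝ} (hN : 0 < N) (h : ∀ i < N, b ≤ a i) :
    b ≤ ∑ i ∈ Finset.range N, (N : ℝ)⁻¹ * a i := by
  have hN' : (0 : ℝ) < N := by exact_mod_cast hN
  rw [← Finset.mul_sum, le_inv_mul_iff₀ hN']
  simpa using Finset.sum_le_sum fun i hi => h i (Finset.mem_range.1 hi)

lemma mem_fieldSpan {Ω E : Type*} {X : ℝ → E → Ω → ℝ} {D : Set E} {η H : ℝ} {x : E}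
    (hH : H ∈ Ioo 0 η) (hx : x ∈ D) : X H x ∈ fieldSpan X D η :=
  Submodule.subset_span ⟨H, hH, x, hx, rfl⟩

lemma probe_mem_fieldSpan {Ω E : Type*} [NormedAddCommGroup E]
    [NormedSpace ℝ E] {X : ℝ → E → Ω → ℝ} {D : Set E} {e : E} {k N : ℕ} {η q κ : ℝ} {x : E}
    (he : ‖e‖ = 1) (hq : q ∈ Ioo 0 η) (hx : Metric.ball x κ ⊆ D)
    (hk : Real.exp (-k) ≤ κ) : probe X e k N q x ∈ fieldSpan X D η :=
  Submodule.sum_mem _ fun _ hi => Submodule.smul_mem _ _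
    (mem_fieldSpan hq (add_probeOffset_mem he hx hk (Finset.mem_range.1 hi)))

namespace IsLogField

variable {Ω E : Type*} [MeasurableSpace Ω] [NormedAddCommGroup E] {P : Measure Ω}
  {D : Set E} {X : ℝ → E → Ω → ℝ} {g : E → E → ℝ} {η δ K : ℝ}

lemma cov_le_of_exp_neg_le (hX : IsLogField P D X g η δ K) {H h L : ℝ} (hH : H ∈ Ioo 0 η)
    (hh : h ∈ Ioo 0 η) {x y : E} (hx : x ∈ D) (hy : y ∈ D) (hL : 0 ≤ L)
    (hxy : Real.exp (-L) ≤ ‖x - y‖) :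
    ∫ ω, X H x ω * X h y ω ∂P ≤ (1 + δ) * L + K := by
  refine (hX.cov_le H hH h hh x hx y hy).trans ?_
  have hδ := hX.delta_pos
  gcongr
  have hp : 0 < H + h := add_pos hH.1 hh.1
  exact max_le ((regNegLog_anti hp (Real.exp_pos _).le hxy).trans (regNegLog_exp_neg_le hp)) hL

lemma cov_le_inv (hX : IsLogField P D X g η δ K) {H h : ℝ} (hH : H ∈ Ioo 0 η)
    (hh : h ∈ Ioo 0 η) {x y : E} (hx : x ∈ D) (hy : y ∈ D) :
    ∫ ω, X H x ω * X h y ω ∂P ≤ (1 + δ) * (1 / (H + h)) + K := by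
  refine (hX.cov_le H hH h hh x hx y hy).trans ?_
  have hδ := hX.delta_pos
  have hp : 0 < H + h := add_pos hH.1 hh.1
  gcongr
  exact max_le (regNegLog_le_inv hp (norm_nonneg _)) (by positivity)

variable [NormedSpace ℝ E] {e : E} {k N : ℕ} {q κ : ℝ} {x y : E}

lemma integral_probe_mul (hX : IsLogField P D X g η δ K) (he : ‖e‖ = 1) (hq : q ∈ Ioo 0 η)
    (hx : Metric.ball x κ ⊆ D) (hk : Real.exp (-k) ≤ κ) {f : Ω → ℝ} (hf : f ∈ fieldSpan X D η) :
    ∫ ω, probe X e k N q x ω * f ω ∂P = ∑ i ∈ Finset.range N, (N : ℝ)⁻¹ *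
      ∫ ω, X q (x + probeOffset e k N i) ω * f ω ∂P :=
  hX.gaussian.integral_sum_smul_mul _ _ _ (fun _ hi =>
    mem_fieldSpan hq (add_probeOffset_mem he hx hk (Finset.mem_range.1 hi))) hf

lemma probe_cov_self_le (hX : IsLogField P D X g η δ K) (he : ‖e‖ = 1) (hN : 0 < N)
    (hq : q ∈ Ioo 0 η) (hx : Metric.ball x κ ⊆ D) (hκ : 0 < κ) (hk : Real.exp (-k) ≤ κ) {h : ℝ}
    (hh : h ∈ Ioo 0 η) :
    ∫ ω, probe X e k N q x ω * X h x ω ∂P ≤ (1 + δ) * k + (K + 12) := by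
  have hxD : x ∈ D := hx (Metric.mem_ball_self hκ)
  rw [hX.integral_probe_mul he hq hx hk (mem_fieldSpan hh hxD)]
  refine average_le hN fun i hi => ?_
  refine (hX.cov_le_of_exp_neg_le (L := k + 3) hq hh (add_probeOffset_mem he hx hk hi) hxD
    (by positivity) ?_).trans ?_
  · rw [add_sub_cancel_left]
    refine le_trans ?_ (le_norm_probeOffset he hi)
    rw [neg_add, Real.exp_add, div_eq_mul_inv]
    gcongr
    rw [Real.exp_neg]
    refine inv_anti₀ (by norm_num) ?_
    have := Real.add_one_le_exp (1 : ℝ)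
    rw [show (3 : ℝ) = 1 + 1 + 1 by norm_num, Real.exp_add, Real.exp_add]
    nlinarith [Real.exp_pos 1]
  · linarith [hX.delta_lt]

lemma probe_var_le (hX : IsLogField P D X g η δ K) (he : ‖e‖ = 1) (hN : 0 < N)
    (hq : q ∈ Ioo 0 η) (hqN : 1 ≤ q * N) (hx : Metric.ball x κ ⊆ D)
    (hk : Real.exp (-k) ≤ κ) :
    ∫ ω, probe X e k N q x ω * probe X e k N q x ω ∂P ≤ (1 + δ) * k + (K + 12) := by
  have hN' : (0 : ℝ) < N := by exact_mod_cast hN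
  have hδ := hX.delta_pos
  have hδ1 := hX.delta_lt
  have hK := hX.const_nonneg
  rw [hX.integral_probe_mul he hq hx hk (probe_mem_fieldSpan he hq hx hk)]
  refine average_le hN fun j hj => ?_
  have hjD := add_probeOffset_mem he hx hk hj
  rw [IsCenteredGaussianSpace.integral_mul_symm,
    hX.integral_probe_mul he hq hx hk (mem_fieldSpan hq hjD), ← Finset.mul_sum,
    inv_mul_le_iff₀ hN', ← Finset.add_sum_erase _ _ (Finset.mem_range.2 hj)]
  have hdiag := hX.cov_le_inv hq hq hjD hjD
  have hinv : 1 / (q + q) ≤ N := by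
    rw [div_le_iff₀ (by linarith [hq.1])]; nlinarith
  have hoff : ∀ i ∈ (Finset.range N).erase j,
      ∫ ω, X q (x + probeOffset e k N i) ω * X q (x + probeOffset e k N j) ω ∂P ≤
        (1 + δ) * (k + 3 + Real.log (N / |(i : ℝ) - j|)) + K := by
    intro i hi
    obtain ⟨hij, hi⟩ := Finset.mem_erase.1 hi
    have hi := Finset.mem_range.1 hi
    have hpos : 0 < |(i : ℝ) - j| := abs_pos.2 (sub_ne_zero.2 (by exact_mod_cast hij))
    have hle : |(i : ℝ) - j| ≤ N := by
      have h1 : (i : ℝ) < N := by exact_mod_cast hi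
      have h2 : (j : ℝ) < N := by exact_mod_cast hj
      have h3 : (0 : ℝ) ≤ i := i.cast_nonneg
      have h4 : (0 : ℝ) ≤ j := j.cast_nonneg
      rw [abs_le]; constructor <;> linarith
    have hlog : 0 ≤ Real.log (N / |(i : ℝ) - j|) :=
      Real.log_nonneg (by rw [le_div_iff₀ hpos]; linarith)
    refine hX.cov_le_of_exp_neg_le hq hq (add_probeOffset_mem he hx hk hi) hjD (by positivity) ?_
    rw [add_sub_add_left_eq_sub, norm_probeOffset_sub he, neg_add, neg_add, Real.exp_add,
      Real.exp_add, Real.exp_neg (Real.log _), Real.exp_log (by positivity)]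
    have h8 : Real.exp (-3) ≤ 1 / 8 := by
      rw [Real.exp_neg, inv_eq_one_div]
      refine one_div_le_one_div_of_le (by norm_num) ?_
      have := Real.add_one_le_exp (1 : ℝ)
      rw [show (3 : ℝ) = 1 + 1 + 1 by norm_num, Real.exp_add, Real.exp_add]
      nlinarith [Real.exp_pos 1]
    calc Real.exp (-k) * Real.exp (-3) * ((N : ℝ) / |(i : ℝ) - j|)⁻¹
        ≤ Real.exp (-k) * (1 / 8) * ((N : ℝ) / |(i : ℝ) - j|)⁻¹ := by gcongr
      _ = _ := by field_simp
  have hsum := Finset.sum_le_sum hoff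
  have hlogs := sum_log_div_abs_sub_le hj
  have hcard : (((Finset.range N).erase j).card : ℝ) = N - 1 := by
    rw [Finset.card_erase_of_mem (Finset.mem_range.2 hj), Finset.card_range, Nat.cast_sub hN]
    simp
  rw [Finset.sum_add_distrib, ← Finset.mul_sum, Finset.sum_add_distrib, Finset.sum_const,
    Finset.sum_const, nsmul_eq_mul, nsmul_eq_mul, hcard] at hsum
  have hk0 : (0 : ℝ) ≤ k := k.cast_nonneg
  have h1 : (1 + δ) * (1 / (q + q)) ≤ (1 + δ) * N := by gcongr
  have h2 : (1 + δ) * ((N - 1) * (k + 3) + ∑ i ∈ (Finset.range N).erase j,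
      Real.log (N / |(i : ℝ) - j|)) ≤ (1 + δ) * ((N * (k + 3)) + 2 * N) := by
    gcongr
    linarith
  nlinarith [mul_le_mul_of_nonneg_right hδ1.le hN'.le]

lemma probe_cov_le_of_far (hX : IsLogField P D X g η δ K) (he : ‖e‖ = 1) (hN : 0 < N)
    (hq : q ∈ Ioo 0 η) (hx : Metric.ball x κ ⊆ D) (hk : Real.exp (-k) ≤ κ) {h : ℝ}
    (hh : h ∈ Ioo 0 η) (hy : y ∈ D) {k₀ : ℕ} (hk₀ : k₀ ≤ k) (hxy : Real.exp (-k₀) ≤ ‖x - y‖) :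
    ∫ ω, probe X e k N q x ω * X h y ω ∂P ≤ (1 + δ) * (k₀ + 1) + K := by
  rw [hX.integral_probe_mul he hq hx hk (mem_fieldSpan hh hy)]
  refine average_le hN fun i hi => ?_
  refine hX.cov_le_of_exp_neg_le hq hh (add_probeOffset_mem he hx hk hi) hy (by positivity) ?_
  have h1 : ‖x - y‖ - ‖probeOffset e k N i‖ ≤ ‖x + probeOffset e k N i - y‖ := by
    have := norm_sub_norm_le (x - y) (-probeOffset e k N i)
    rw [norm_neg] at this
    refine this.trans (le_of_eq ?_)
    congr 1; abel
  have h2 := norm_probeOffset_le (k := k) he hi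
  have h3 : Real.exp (-(k : ℝ)) ≤ Real.exp (-(k₀ : ℝ)) := by gcongr
  have h4 : Real.exp (-((k₀ : ℝ) + 1)) ≤ Real.exp (-k₀) * (1 / 2) := by
    rw [neg_add, Real.exp_add]
    gcongr
    rw [Real.exp_neg, inv_eq_one_div]
    exact one_div_le_one_div_of_le (by norm_num) (by linarith [Real.add_one_le_exp (1 : ℝ)])
  linarith [Real.exp_pos (-(k₀ : ℝ))]

lemma le_probe_cov_of_near (hX : IsLogField P D X g η δ K) (he : ‖e‖ = 1) (hN : 0 < N)
    (hq : q ∈ Ioo 0 η) (hx : Metric.ball x κ ⊆ D) (hk : Real.exp (-k) ≤ κ) {h L : ℝ}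
    (hh : h ∈ Ioo 0 η) (hy : y ∈ D) (hL : 0 < L) (hkL : L ≤ k) (hqL : q * L ≤ δ)
    (hxy : ‖x - y‖ ≤ Real.exp (-L)) :
    (1 - δ) * (regNegLog h (Real.exp (-L)) - δ * L - 1) - K ≤
      ∫ ω, probe X e k N q x ω * X h y ω ∂P := by
  have hδ1 := hX.delta_lt
  rw [hX.integral_probe_mul he hq hx hk (mem_fieldSpan hh hy)]
  refine le_average hN fun i hi => ?_
  refine le_trans ?_ (hX.le_cov q hq h hh _ (add_probeOffset_mem he hx hk hi) y hy)
  have hp : 0 < q + h := add_pos hq.1 hh.1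
  have hp1 : q + h ≤ 1 := by linarith [hX.le_half, hq.2, hh.2]
  have h1 : ‖x + probeOffset e k N i - y‖ ≤ 2 * Real.exp (-L) := by
    have h2 := norm_add_le (x - y) (probeOffset e k N i)
    have h3 := norm_probeOffset_le (k := k) he hi
    have h4 : Real.exp (-(k : ℝ)) ≤ Real.exp (-L) := by gcongr
    rw [show x + probeOffset e k N i - y = x - y + probeOffset e k N i by abel]
    linarith [Real.exp_pos (-L)]
  have h2 := regNegLog_anti hp (norm_nonneg _) h1
  have h3 := regNegLog_sub_one_le hp hp1 (Real.exp_pos (-L)).le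
    (Real.exp_le_one_iff.2 (by linarith))
  have h4 := regNegLog_exp_neg_sub_le hh.1 hq.1 hL
  have h5 : q * L ^ 2 ≤ δ * L := by nlinarith
  have : 0 ≤ 1 - δ := by linarith
  gcongr
  linarith

lemma abs_probe_cov_sub_le (hX : IsLogField P D X g η δ K) (he : ‖e‖ = 1) (hN : 0 < N)
    (hq : q ∈ Ioo 0 η) (hx : Metric.ball x κ ⊆ D) (hk : Real.exp (-k) ≤ κ) {h τ : ℝ}
    (hh : h ∈ Ioo 0 η) (hy : y ∈ D)
    (hτ : ∀ i < N, |∫ ω, X q (x + probeOffset e k N i) ω * X h y ω ∂P -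
      (-Real.log ‖x + probeOffset e k N i - y‖ + g (x + probeOffset e k N i) y)| ≤ τ) :
    |∫ ω, probe X e k N q x ω * X h y ω ∂P - ∑ i ∈ Finset.range N, (N : ℝ)⁻¹ *
      (-Real.log ‖x + probeOffset e k N i - y‖ + g (x + probeOffset e k N i) y)| ≤ τ := by
  rw [hX.integral_probe_mul he hq hx hk (mem_fieldSpan hh hy), ← Finset.sum_sub_distrib]
  simp_rw [← mul_sub]
  rw [abs_le]
  exact ⟨le_average hN fun i hi => (abs_le.1 (hτ i hi)).1,
    average_le hN fun i hi => (abs_le.1 (hτ i hi)).2⟩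

end IsLogField

/-- The normalised exponential of a centered variable. -/
noncomputable def wickExp {Ω : Type*} [MeasurableSpace Ω] (P : Measure Ω) (f : Ω → ℝ) (ω : Ω) : ℝ :=
  Real.exp (f ω - (∫ ω', f ω' * f ω' ∂P) / 2)

lemma wickExp_pos {Ω : Type*} [MeasurableSpace Ω] {P : Measure Ω} (f : Ω → ℝ) (ω : Ω) :
    0 < wickExp P f ω := Real.exp_pos _

namespace IsCenteredGaussianSpace

variable {Ω : Type*} [MeasurableSpace Ω] {P : Measure Ω} {S : Submodule ℝ (Ω → ℝ)}
  {f f' W : Ω → ℝ}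

lemma wickExp_mul_wickExp (hS : IsCenteredGaussianSpace P S) (hf : f ∈ S) (hf' : f' ∈ S) (ω : Ω) :
    wickExp P f ω * wickExp P f' ω =
      Real.exp (∫ ω', f ω' * f' ω' ∂P) * wickExp P (f + f') ω := by
  have hff := S.add_mem hf hf'
  simp only [wickExp]
  rw [hS.integral_add_mul hf hf' hff, integral_mul_symm f (f + f'), integral_mul_symm f' (f + f'),
    hS.integral_add_mul hf hf' hf, hS.integral_add_mul hf hf' hf', integral_mul_symm f' f,
    ← Real.exp_add, ← Real.exp_add, Pi.add_apply]
  congr 1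
  ring

lemma integral_smul_mul_smul (c : ℝ) (f h : Ω → ℝ) :
    ∫ ω, (c • f) ω * (c • h) ω ∂P = c ^ 2 * ∫ ω, f ω * h ω ∂P := by
  rw [integral_smul_mul, integral_mul_symm, integral_smul_mul, integral_mul_symm, ← mul_assoc, sq]

lemma integrable_wickExp_mul_exp (hS : IsCenteredGaussianSpace P S) (hf : f ∈ S) (hW : W ∈ S)
    (s a : ℝ) : Integrable (fun ω => wickExp P f ω * Real.exp (s * (W ω - a))) P := by
  have h := (hS.integrable_exp (S.add_mem hf (S.smul_mem s hW))).mul_const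
    (Real.exp (-(s * a) - (∫ ω', f ω' * f ω' ∂P) / 2))
  refine h.congr (ae_of_all _ fun ω => ?_)
  simp only [wickExp]
  rw [← Real.exp_add, ← Real.exp_add]
  congr 1
  simp only [Pi.add_apply, Pi.smul_apply, smul_eq_mul]
  ring

lemma integral_wickExp_mul_exp (hS : IsCenteredGaussianSpace P S) (hf : f ∈ S) (hW : W ∈ S)
    (s a : ℝ) : ∫ ω, wickExp P f ω * Real.exp (s * (W ω - a)) ∂P =
      Real.exp (s * (∫ ω, f ω * W ω ∂P) + s ^ 2 * (∫ ω, W ω * W ω ∂P) / 2 - s * a) := by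
  have h1 : ∀ ω, wickExp P f ω * Real.exp (s * (W ω - a)) =
      Real.exp (f ω + s * W ω) * Real.exp (-(s * a) - (∫ ω', f ω' * f ω' ∂P) / 2) := fun ω => by
    simp only [wickExp]
    rw [← Real.exp_add, ← Real.exp_add]
    congr 1
    ring
  simp_rw [h1]
  rw [integral_mul_const, hS.integral_exp_add_smul hf hW, ← Real.exp_add, ← Real.exp_add]
  congr 1
  ring

lemma integrable_wickExp (hS : IsCenteredGaussianSpace P S) (hf : f ∈ S) :
    Integrable (wickExp P f) P := by
  simpa using hS.integrable_wickExp_mul_exp hf hf 0 0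

lemma integral_wickExp (hS : IsCenteredGaussianSpace P S) (hf : f ∈ S) :
    ∫ ω, wickExp P f ω ∂P = 1 := by
  simpa using hS.integral_wickExp_mul_exp hf hf 0 0

lemma integrable_wickExp_mul_wickExp (hS : IsCenteredGaussianSpace P S) (hf : f ∈ S)
    (hf' : f' ∈ S) : Integrable (fun ω => wickExp P f ω * wickExp P f' ω) P := by
  simp_rw [hS.wickExp_mul_wickExp hf hf']
  exact (hS.integrable_wickExp (S.add_mem hf hf')).const_mul _

lemma integral_wickExp_mul_wickExp (hS : IsCenteredGaussianSpace P S) (hf : f ∈ S)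
    (hf' : f' ∈ S) :
    ∫ ω, wickExp P f ω * wickExp P f' ω ∂P = Real.exp (∫ ω, f ω * f' ω ∂P) := by
  simp_rw [hS.wickExp_mul_wickExp hf hf']
  rw [integral_const_mul, hS.integral_wickExp (S.add_mem hf hf'), mul_one]

end IsCenteredGaussianSpace

/-- A Lipschitz cutoff, equal to `1` below `a` and to `0` above `a + 1`. -/
noncomputable def cutoff (a w : ℝ) : ℝ := max 0 (min 1 (a + 1 - w))

lemma cutoff_nonneg (a w : ℝ) : 0 ≤ cutoff a w := le_max_left _ _

lemma cutoff_le_one (a w : ℝ) : cutoff a w ≤ 1 := max_le zero_le_one (min_le_left _ _)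

lemma measurable_cutoff (a : ℝ) : Measurable (cutoff a) := by unfold cutoff; fun_prop

lemma abs_cutoff_sub_le (a w w' : ℝ) : |cutoff a w - cutoff a w'| ≤ |w - w'| := by
  unfold cutoff
  refine (abs_max_sub_max_le_max _ _ _ _).trans (max_le (by simp) ?_)
  refine (abs_min_sub_min_le_max _ _ _ _).trans (max_le (by simp) (le_of_eq ?_))
  rw [sub_sub_sub_cancel_left, abs_sub_comm]

lemma one_sub_cutoff_le {θ : ℝ} (hθ : 0 ≤ θ) (a w : ℝ) :
    1 - cutoff a w ≤ Real.exp (θ * (w - a)) := by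
  rcases le_total w a with h | h
  · have : cutoff a w = 1 := by
      rw [cutoff, min_eq_left (by linarith), max_eq_right zero_le_one]
    rw [this, sub_self]; positivity
  · have := Real.one_le_exp (mul_nonneg hθ (sub_nonneg.2 h))
    linarith [cutoff_nonneg a w]

lemma cutoff_le_exp {θ : ℝ} (hθ : 0 ≤ θ) (a w : ℝ) :
    cutoff a w ≤ Real.exp (-θ * (w - (a + 1))) := by
  rcases le_total w (a + 1) with h | h
  · refine (cutoff_le_one a w).trans (Real.one_le_exp ?_)
    nlinarith
  · have : cutoff a w = 0 := by
      rw [cutoff, max_eq_left]; exact (min_le_right _ _).trans (by linarith)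
    rw [this]; positivity

lemma one_sub_prod_le_sum {ι : Type*} (s : Finset ι) {u : ι → ℝ} (h0 : ∀ i ∈ s, 0 ≤ u i)
    (h1 : ∀ i ∈ s, u i ≤ 1) : 1 - ∏ i ∈ s, u i ≤ ∑ i ∈ s, (1 - u i) := by
  classical
  induction s using Finset.induction_on with
  | empty => simp
  | insert a s ha ih =>
    rw [Finset.prod_insert ha, Finset.sum_insert ha]
    have h2 := ih (fun i hi => h0 i (Finset.mem_insert_of_mem hi))
      fun i hi => h1 i (Finset.mem_insert_of_mem hi)
    have h3 : ∏ i ∈ s, u i ≤ 1 := Finset.prod_le_one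
      (fun i hi => h0 i (Finset.mem_insert_of_mem hi))
      fun i hi => h1 i (Finset.mem_insert_of_mem hi)
    have h4 := h1 a (Finset.mem_insert_self _ _)
    nlinarith [mul_nonneg (sub_nonneg.2 h4) (sub_nonneg.2 h3)]

lemma abs_prod_sub_prod_le_sum {ι : Type*} (s : Finset ι) {u u' : ι → ℝ} (h0 : ∀ i ∈ s, 0 ≤ u i)
    (h1 : ∀ i ∈ s, u i ≤ 1) (h0' : ∀ i ∈ s, 0 ≤ u' i) (h1' : ∀ i ∈ s, u' i ≤ 1) :
    |∏ i ∈ s, u i - ∏ i ∈ s, u' i| ≤ ∑ i ∈ s, |u i - u' i| := by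
  classical
  induction s using Finset.induction_on with
  | empty => simp
  | insert a s ha ih =>
    rw [Finset.prod_insert ha, Finset.prod_insert ha, Finset.sum_insert ha]
    simp only [Finset.forall_mem_insert] at h0 h1 h0' h1'
    have h2 := ih h0.2 h1.2 h0'.2 h1'.2
    have h3 : |∏ i ∈ s, u i| ≤ 1 := by
      rw [abs_of_nonneg (Finset.prod_nonneg h0.2)]
      exact Finset.prod_le_one h0.2 h1.2
    have h4 : |u' a| ≤ 1 := by rw [abs_of_nonneg h0'.1]; exact h1'.1
    calc |u a * ∏ i ∈ s, u i - u' a * ∏ i ∈ s, u' i|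
        = |(u a - u' a) * ∏ i ∈ s, u i + u' a * (∏ i ∈ s, u i - ∏ i ∈ s, u' i)| := by
          congr 1; ring
      _ ≤ |u a - u' a| * |∏ i ∈ s, u i| + |u' a| * |∏ i ∈ s, u i - ∏ i ∈ s, u' i| := by
          rw [← abs_mul, ← abs_mul]; exact abs_add_le _ _
      _ ≤ |u a - u' a| * 1 + 1 * |∏ i ∈ s, u i - ∏ i ∈ s, u' i| := by gcongr
      _ ≤ _ := by linarith

/-- The product over the scales in `s` of the cutoffs of the probes at height `α k`. -/
noncomputable def barrier {Ω E : Type*} [AddCommGroup E] [Module ℝ E] (X : ℝ → E → Ω → ℝ) (e : E)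
    (N : ℕ → ℕ) (q : ℕ → ℝ) (α : ℝ) (s : Finset ℕ) (x : E) (ω : Ω) : ℝ :=
  ∏ k ∈ s, cutoff (α * k) (probe X e k (N k) (q k) x ω)

/-- Admissible parameters for probes at all scales from `k₀` on, around points at distance at least
`κ` from the complement of the domain. -/
structure IsProbeFamily {E : Type*} [NormedAddCommGroup E] (e : E) (N : ℕ → ℕ) (q : ℕ → ℝ)
    (η δ κ : ℝ) (k₀ : ℕ) : Prop where
  norm_eq : ‖e‖ = 1
  pos : ∀ k, 0 < N k
  mem : ∀ k, q k ∈ Ioo 0 η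
  one_le : ∀ k, 1 ≤ q k * N k
  mul_le : ∀ k, q k * k ≤ δ
  kappa_pos : 0 < κ
  exp_le : ∀ k, k₀ ≤ k → Real.exp (-k) ≤ κ

lemma exists_isProbeFamily {E : Type*} [NormedAddCommGroup E] {e : E} (he : ‖e‖ = 1) {η δ κ t : ℝ}
    (hη : 0 < η) (hδ : 0 < δ) (hκ : 0 < κ) (ht : 0 < t) {k₀ : ℕ} (hk₀ : Real.exp (-k₀) ≤ κ) :
    ∃ N q, IsProbeFamily e N q η δ κ k₀ ∧ ∀ k, q k < t := by
  set q : ℕ → ℝ := fun k => min (min (η / 2) (t / 2)) (δ / (k + 1)) with hq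
  have hq0 : ∀ k, 0 < q k := fun k => by positivity
  have h1 : ∀ k, q k ≤ η / 2 := fun k => (min_le_left _ _).trans (min_le_left _ _)
  have h2 : ∀ k, q k ≤ t / 2 := fun k => (min_le_left _ _).trans (min_le_right _ _)
  have h3 : ∀ k, q k ≤ δ / (k + 1) := fun k => min_le_right _ _
  refine ⟨fun k => ⌈1 / q k⌉₊, q, ⟨he, fun k => ?_, fun k => ⟨hq0 k, ?_⟩, fun k => ?_, fun k => ?_, hκ,
    fun k hk => ?_⟩, fun k => ?_⟩
  · exact Nat.ceil_pos.2 (by have := hq0 k; positivity)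
  · linarith [h1 k]
  · have := Nat.le_ceil (1 / q k)
    rw [div_le_iff₀ (hq0 k)] at this
    linarith
  · have := h3 k
    rw [le_div_iff₀ (by positivity)] at this
    nlinarith [hq0 k]
  · refine le_trans ?_ hk₀
    gcongr
  · linarith [h2 k]

section Barrier

variable {Ω E : Type*} [AddCommGroup E] [Module ℝ E] {X : ℝ → E → Ω → ℝ} {e : E}
    {N : ℕ → ℕ} {q : ℕ → ℝ} {α : ℝ} {s t : Finset ℕ} {x : E} {ω : Ω}

lemma barrier_nonneg : 0 ≤ barrier X e N q α s x ω :=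
  Finset.prod_nonneg fun _ _ => cutoff_nonneg _ _

lemma barrier_le_one : barrier X e N q α s x ω ≤ 1 :=
  Finset.prod_le_one (fun _ _ => cutoff_nonneg _ _) fun _ _ => cutoff_le_one _ _

lemma barrier_le_cutoff {k : ℕ} (hk : k ∈ s) :
    barrier X e N q α s x ω ≤ cutoff (α * k) (probe X e k (N k) (q k) x ω) := by
  rw [barrier, ← Finset.mul_prod_erase _ _ hk]
  exact mul_le_of_le_one_right (cutoff_nonneg _ _)
    (Finset.prod_le_one (fun _ _ => cutoff_nonneg _ _) fun _ _ => cutoff_le_one _ _)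

lemma one_sub_barrier_le : 1 - barrier X e N q α s x ω ≤
    ∑ k ∈ s, (1 - cutoff (α * k) (probe X e k (N k) (q k) x ω)) :=
  one_sub_prod_le_sum s (fun _ _ => cutoff_nonneg _ _) fun _ _ => cutoff_le_one _ _

lemma barrier_union (h : Disjoint s t) : barrier X e N q α (s ∪ t) x ω =
    barrier X e N q α s x ω * barrier X e N q α t x ω :=
  Finset.prod_union h

end Barrier

lemma smul_mem_fieldSpan {Ω E : Type*} {X : ℝ → E → Ω → ℝ} {D : Set E} {η H γ : ℝ} {x : E}
    (hH : H ∈ Ioo 0 η) (hx : x ∈ D) : γ • X H x ∈ fieldSpan X D η :=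
  Submodule.smul_mem _ _ (mem_fieldSpan hH hx)

lemma IsProbeFamily.probe_mem {Ω E : Type*} [NormedAddCommGroup E] [NormedSpace ℝ E] {D : Set E}
    {X : ℝ → E → Ω → ℝ} {η δ κ : ℝ} {e x : E} {N : ℕ → ℕ} {q : ℕ → ℝ} {k₀ k : ℕ}
    (hF : IsProbeFamily e N q η δ κ k₀) (hk : k₀ ≤ k) (hx : Metric.ball x κ ⊆ D) :
    probe X e k (N k) (q k) x ∈ fieldSpan X D η :=
  probe_mem_fieldSpan hF.norm_eq (hF.mem k) hx (hF.exp_le k hk)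

namespace IsLogField

variable {Ω E : Type*} [MeasurableSpace Ω] [NormedAddCommGroup E] [NormedSpace ℝ E]
  {P : Measure Ω} {D : Set E} {X : ℝ → E → Ω → ℝ} {g : E → E → ℝ} {η δ K : ℝ} {e : E} {N : ℕ → ℕ}
  {q : ℕ → ℝ} {κ γ α H h : ℝ} {k₀ k : ℕ} {s t : Finset ℕ} {x y : E}

lemma measurable_cutoff_probe (hX : IsLogField P D X g η δ K)
    (hF : IsProbeFamily e N q η δ κ k₀) (hk : k₀ ≤ k) (hx : Metric.ball x κ ⊆ D) (a : ℝ) :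
    Measurable fun ω => cutoff a (probe X e k (N k) (q k) x ω) :=
  (measurable_cutoff a).comp (hX.gaussian _ (hF.probe_mem hk hx)).1

lemma measurable_barrier (hX : IsLogField P D X g η δ K)
    (hF : IsProbeFamily e N q η δ κ k₀) (hs : ∀ k ∈ s, k₀ ≤ k) (hx : Metric.ball x κ ⊆ D) :
    Measurable (barrier X e N q α s x) :=
  Finset.measurable_fun_prod _ fun k hk => measurable_cutoff_probe hX hF (hs k hk) hx _

lemma integrable_wickExp_mul_one_sub_cutoff (hX : IsLogField P D X g η δ K)
    (hF : IsProbeFamily e N q η δ κ k₀) (hk : k₀ ≤ k) (hx : Metric.ball x κ ⊆ D) (a : ℝ)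
    {f : Ω → ℝ} (hf : f ∈ fieldSpan X D η) :
    Integrable (fun ω => wickExp P f ω * (1 - cutoff a (probe X e k (N k) (q k) x ω))) P := by
  refine (hX.gaussian.integrable_wickExp hf).mul_bdd (c := 1)
    (measurable_const.sub (measurable_cutoff_probe hX hF hk hx a)).aestronglyMeasurable
    (ae_of_all _ fun ω => ?_)
  rw [Real.norm_eq_abs, abs_le]
  constructor <;> linarith [cutoff_nonneg a (probe X e k (N k) (q k) x ω),
    cutoff_le_one a (probe X e k (N k) (q k) x ω)]

lemma integral_wickExp_mul_one_sub_cutoff_le (hX : IsLogField P D X g η δ K)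
    (hF : IsProbeFamily e N q η δ κ k₀) (hk : k₀ ≤ k) (hx : Metric.ball x κ ⊆ D) (hγ : 0 < γ)
    {f : Ω → ℝ} (hf : f ∈ fieldSpan X D η) {B : ℝ}
    (hfB : ∫ ω, f ω * probe X e k (N k) (q k) x ω ∂P ≤
      γ * ((1 + δ) * k + (K + 12) + B)) :
    ∫ ω, wickExp P f ω * (1 - cutoff (γ * (1 + 3 * δ) * k) (probe X e k (N k) (q k) x ω)) ∂P ≤
      Real.exp (γ ^ 2 * δ * (2 * (K + 12) + B)) * Real.exp (-(γ * δ) ^ 2) ^ k := by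
  have hδ := hX.delta_pos
  have hδ1 := hX.delta_lt
  have hK := hX.const_nonneg
  have hW := hF.probe_mem (X := X) hk hx
  have hv := hX.probe_var_le hF.norm_eq (hF.pos k) (hF.mem k) (hF.one_le k) hx (hF.exp_le k hk)
  have hmono : ∫ ω, wickExp P f ω * (1 - cutoff (γ * (1 + 3 * δ) * k)
      (probe X e k (N k) (q k) x ω)) ∂P ≤ ∫ ω, wickExp P f ω *
        Real.exp (γ * δ * (probe X e k (N k) (q k) x ω - γ * (1 + 3 * δ) * k)) ∂P := by
    refine integral_mono (integrable_wickExp_mul_one_sub_cutoff hX hF hk hx _ hf)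
      (hX.gaussian.integrable_wickExp_mul_exp hf hW _ _) fun ω => ?_
    exact mul_le_mul_of_nonneg_left (one_sub_cutoff_le (by positivity) _ _) (wickExp_pos _ _).le
  refine hmono.trans ?_
  rw [hX.gaussian.integral_wickExp_mul_exp hf hW, ← Real.exp_nat_mul, ← Real.exp_add]
  refine Real.exp_le_exp.2 ?_
  set c := ∫ ω, f ω * probe X e k (N k) (q k) x ω ∂P
  set v := ∫ ω, probe X e k (N k) (q k) x ω * probe X e k (N k) (q k) x ω ∂P
  have h1 : γ * δ * c ≤ γ * δ * (γ * ((1 + δ) * k + (K + 12) + B)) := by gcongr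
  have h2 : (γ * δ) ^ 2 * v / 2 ≤ (γ * δ) ^ 2 * ((1 + δ) * k + (K + 12)) / 2 := by gcongr
  have hk0 : (0 : ℝ) ≤ k := k.cast_nonneg
  have h3 : 0 ≤ γ ^ 2 * δ * ((1 - δ / 2) * (K + 12) + δ * (1 / 2 - δ / 2) * k) := by
    have : 0 ≤ 1 - δ / 2 := by linarith
    have : 0 ≤ 1 / 2 - δ / 2 := by linarith
    positivity
  nlinarith

/-- The first moment on the event that the barrier is crossed at scale `k`. -/
lemma bad_moment_le (hX : IsLogField P D X g η δ K)
    (hF : IsProbeFamily e N q η δ κ k₀) (hk : k₀ ≤ k) (hx : Metric.ball x κ ⊆ D) (hγ : 0 < γ)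
    (hH : H ∈ Ioo 0 η) :
    ∫ ω, wickExp P (γ • X H x) ω *
      (1 - cutoff (γ * (1 + 3 * δ) * k) (probe X e k (N k) (q k) x ω)) ∂P ≤
      Real.exp (γ ^ 2 * δ * (2 * (K + 12))) * Real.exp (-(γ * δ) ^ 2) ^ k := by
  have hxD : x ∈ D := hx (Metric.mem_ball_self hF.kappa_pos)
  have h := hX.probe_cov_self_le hF.norm_eq (hF.pos k) (hF.mem k) hx hF.kappa_pos
    (hF.exp_le k hk) hH
  have := integral_wickExp_mul_one_sub_cutoff_le hX hF hk hx hγ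
    (smul_mem_fieldSpan (γ := γ) hH hxD) (B := 0) (by
    rw [IsCenteredGaussianSpace.integral_smul_mul, IsCenteredGaussianSpace.integral_mul_symm,
      add_zero]
    exact mul_le_mul_of_nonneg_left h hγ.le)
  rwa [add_zero] at this

/-- The mixed second moment at macroscopic distance on the event that the barrier is crossed at
scale `k`. -/
lemma far_moment_le (hX : IsLogField P D X g η δ K)
    (hF : IsProbeFamily e N q η δ κ k₀) (hk : k₀ ≤ k) (hx : Metric.ball x κ ⊆ D) (hγ : 0 < γ)
    (hH : H ∈ Ioo 0 η) (hh : h ∈ Ioo 0 η) (hy : y ∈ D) (hxy : Real.exp (-k₀) ≤ ‖x - y‖) :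
    ∫ ω, wickExp P (γ • X H x) ω * wickExp P (γ • X h y) ω *
      (1 - cutoff (γ * (1 + 3 * δ) * k) (probe X e k (N k) (q k) x ω)) ∂P ≤
      Real.exp (γ ^ 2 * (2 * k₀ + K) + γ ^ 2 * δ * (2 * (K + 12) + (2 * (k₀ + 1) + K))) *
        Real.exp (-(γ * δ) ^ 2) ^ k := by
  have hδ := hX.delta_pos
  have hδ1 := hX.delta_lt
  have hxD : x ∈ D := hx (Metric.mem_ball_self hF.kappa_pos)
  have hfx := smul_mem_fieldSpan (X := X) (γ := γ) hH hxD
  have hfy := smul_mem_fieldSpan (X := X) (γ := γ) hh hy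
  have hW := hF.probe_mem (X := X) hk hx
  simp_rw [hX.gaussian.wickExp_mul_wickExp hfx hfy, mul_assoc]
  rw [integral_const_mul, Real.exp_add, mul_assoc]
  have h1 := hX.probe_cov_self_le hF.norm_eq (hF.pos k) (hF.mem k) hx hF.kappa_pos
    (hF.exp_le k hk) hH
  have h2 := hX.probe_cov_le_of_far hF.norm_eq (hF.pos k) (hF.mem k) hx (hF.exp_le k hk) hh hy hk hxy
  have h3 := hX.cov_le_of_exp_neg_le hH hh hxD hy k₀.cast_nonneg hxy
  have hk0 : (0 : ℝ) ≤ k₀ := k₀.cast_nonneg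
  refine mul_le_mul (Real.exp_le_exp.2 ?_) ?_ ?_ (Real.exp_pos _).le
  · rw [IsCenteredGaussianSpace.integral_smul_mul_smul]
    refine mul_le_mul_of_nonneg_left ?_ (sq_nonneg γ)
    nlinarith
  · rw [← mul_assoc]
    have := integral_wickExp_mul_one_sub_cutoff_le hX hF hk hx hγ (Submodule.add_mem _ hfx hfy)
      (B := 2 * (k₀ + 1) + K) (by
        rw [hX.gaussian.integral_add_mul hfx hfy hW, IsCenteredGaussianSpace.integral_smul_mul,
          IsCenteredGaussianSpace.integral_smul_mul, IsCenteredGaussianSpace.integral_mul_symm,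
          IsCenteredGaussianSpace.integral_mul_symm (X h y), ← mul_add]
        refine mul_le_mul_of_nonneg_left ?_ hγ.le
        nlinarith)
    simpa only [mul_assoc] using this
  · refine integral_nonneg fun ω => mul_nonneg (wickExp_pos _ _).le ?_
    linarith [cutoff_le_one (γ * ((1 + 3 * δ) * k)) (probe X e k (N k) (q k) x ω)]

lemma integrable_wickExp_mul_barrier (hX : IsLogField P D X g η δ K)
    (hF : IsProbeFamily e N q η δ κ k₀) (hs : ∀ k ∈ s, k₀ ≤ k) (hx : Metric.ball x κ ⊆ D)
    {f : Ω → ℝ} (hf : f ∈ fieldSpan X D η) :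
    Integrable (fun ω => wickExp P f ω * barrier X e N q α s x ω) P := by
  refine (hX.gaussian.integrable_wickExp hf).mul_bdd (c := 1)
    (measurable_barrier hX hF hs hx).aestronglyMeasurable (ae_of_all _ fun ω => ?_)
  rw [Real.norm_eq_abs, abs_of_nonneg barrier_nonneg]
  exact barrier_le_one

lemma integrable_mul_barrier_mul_barrier (hX : IsLogField P D X g η δ K)
    (hF : IsProbeFamily e N q η δ κ k₀) (hs : ∀ k ∈ s, k₀ ≤ k) (hx : Metric.ball x κ ⊆ D)
    (hy : Metric.ball y κ ⊆ D) {Y : Ω → ℝ} (hY : Integrable Y P) :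
    Integrable (fun ω => Y ω * (barrier X e N q α s x ω * barrier X e N q α s y ω)) P := by
  refine hY.mul_bdd (c := 1)
    ((measurable_barrier hX hF hs hx).mul (measurable_barrier hX hF hs hy)).aestronglyMeasurable
    (ae_of_all _ fun ω => ?_)
  rw [Real.norm_eq_abs, abs_of_nonneg (mul_nonneg barrier_nonneg barrier_nonneg)]
  exact mul_le_one₀ barrier_le_one barrier_nonneg barrier_le_one

/-- The second moment at small distance, below the barrier. -/
lemma near_moment_le (hX : IsLogField P D X g η δ K)
    (hF : IsProbeFamily e N q η δ κ k₀) (hs : ∀ k ∈ s, k₀ ≤ k) (hx : Metric.ball x κ ⊆ D)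
    (hy : Metric.ball y κ ⊆ D) (hγ : 0 < γ) (hH : H ∈ Ioo 0 η) {L : ℝ} (hL : 0 < L)
    (hxy : ‖x - y‖ = Real.exp (-L)) (hsL : ⌈L⌉₊ ∈ s ∨ 1 ≤ H * L) :
    ∫ ω, wickExp P (γ • X H x) ω * wickExp P (γ • X H y) ω *
      (barrier X e N q (γ * (1 + 3 * δ)) s x ω * barrier X e N q (γ * (1 + 3 * δ)) s y ω) ∂P ≤
      Real.exp (γ ^ 2 * ((1 / 2 + 9 * δ) * L + (4 * K + 13)) + γ) := by
  have hδ := hX.delta_pos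
  have hδ1 := hX.delta_lt
  have hK := hX.const_nonneg
  have hxD : x ∈ D := hx (Metric.mem_ball_self hF.kappa_pos)
  have hyD : y ∈ D := hy (Metric.mem_ball_self hF.kappa_pos)
  have hfx := smul_mem_fieldSpan (X := X) (γ := γ) hH hxD
  have hfy := smul_mem_fieldSpan (X := X) (γ := γ) hH hyD
  have hYY := hX.gaussian.integrable_wickExp_mul_wickExp hfx hfy
  have hFint := integrable_mul_barrier_mul_barrier (α := γ * (1 + 3 * δ)) hX hF hs hx hy hYY
  have hcov := hX.cov_le H hH H hH x hxD y hyD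
  rw [hxy, max_eq_left (regNegLog_exp_neg_nonneg (by linarith [hH.1]) hL.le)] at hcov
  have hvL := regNegLog_exp_neg_le (p := H + H) (L := L) (by linarith [hH.1])
  have hpos : ∀ ω, 0 ≤ wickExp P (γ • X H x) ω * wickExp P (γ • X H y) ω := fun ω =>
    (mul_pos (wickExp_pos _ _) (wickExp_pos _ _)).le
  have hsm : ∫ ω, (γ • X H x) ω * (γ • X H y) ω ∂P = γ ^ 2 * ∫ ω, X H x ω * X H y ω ∂P :=
    IsCenteredGaussianSpace.integral_smul_mul_smul _ _ _
  rcases hsL with hs' | hHL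
  · set k := ⌈L⌉₊ with hkdef
    have hk := hs k hs'
    have hkL : L ≤ k := Nat.le_ceil L
    have hkL' : (k : ℝ) ≤ L + 1 := (Nat.ceil_lt_add_one hL.le).le
    have hqL : q k * L ≤ δ := (mul_le_mul_of_nonneg_left hkL (hF.mem k).1.le).trans (hF.mul_le k)
    have hW := hF.probe_mem (X := X) hk hx
    obtain ⟨t, z, ht0, ht1, hz0, hz1, htz, htle⟩ := exists_tilt hH.1 hL
    have hv := hX.probe_var_le hF.norm_eq (hF.pos k) (hF.mem k) (hF.one_le k) hx (hF.exp_le k hk)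
    have hc1 := hX.le_probe_cov_of_near hF.norm_eq (hF.pos k) (hF.mem k) hx (hF.exp_le k hk) hH hxD
      hL hkL hqL (by simpa using (Real.exp_pos (-L)).le)
    have hc2 := hX.le_probe_cov_of_near hF.norm_eq (hF.pos k) (hF.mem k) hx (hF.exp_le k hk) hH hyD
      hL hkL hqL hxy.le
    have hmono : ∫ ω, wickExp P (γ • X H x) ω * wickExp P (γ • X H y) ω *
        (barrier X e N q (γ * (1 + 3 * δ)) s x ω * barrier X e N q (γ * (1 + 3 * δ)) s y ω) ∂P ≤
        ∫ ω, Real.exp (∫ ω', (γ • X H x) ω' * (γ • X H y) ω' ∂P) *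
          (wickExp P (γ • X H x + γ • X H y) ω * Real.exp (-(γ * t) *
            (probe X e k (N k) (q k) x ω - (γ * (1 + 3 * δ) * k + 1)))) ∂P := by
      refine integral_mono hFint ((hX.gaussian.integrable_wickExp_mul_exp
        (Submodule.add_mem _ hfx hfy) hW _ _).const_mul _) fun ω => ?_
      simp only
      rw [← mul_assoc (Real.exp _), ← hX.gaussian.wickExp_mul_wickExp hfx hfy]
      refine mul_le_mul_of_nonneg_left ?_ (hpos ω)
      exact (mul_le_of_le_one_right barrier_nonneg barrier_le_one).trans
        ((barrier_le_cutoff hs').trans (cutoff_le_exp (by positivity) _ _))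
    refine hmono.trans ?_
    rw [integral_const_mul, hX.gaussian.integral_wickExp_mul_exp (Submodule.add_mem _ hfx hfy) hW,
      ← Real.exp_add, hsm, hX.gaussian.integral_add_mul hfx hfy hW,
      IsCenteredGaussianSpace.integral_smul_mul, IsCenteredGaussianSpace.integral_smul_mul,
      IsCenteredGaussianSpace.integral_mul_symm (X H x) (probe X e k (N k) (q k) x),
      IsCenteredGaussianSpace.integral_mul_symm (X H y) (probe X e k (N k) (q k) x)]
    refine Real.exp_le_exp.2 ?_
    set c := ∫ ω, X H x ω * X H y ω ∂P
    set c1 := ∫ ω, probe X e k (N k) (q k) x ω * X H x ω ∂P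
    set c2 := ∫ ω, probe X e k (N k) (q k) x ω * X H y ω ∂P
    set v := ∫ ω, probe X e k (N k) (q k) x ω * probe X e k (N k) (q k) x ω ∂P
    rw [htz] at hc1 hc2
    have hlow : L * z - 2 * δ * L - 1 - K ≤ (1 - δ) * (L * z - δ * L - 1) - K := by
      have : δ * (L * z) ≤ δ * L := by
        refine mul_le_mul_of_nonneg_left ?_ hδ.le
        nlinarith
      nlinarith [mul_nonneg (mul_nonneg hδ.le hδ.le) hL.le]
    have hC1 : t * (L * z - 2 * δ * L - 1 - K) ≤ t * c1 := by gcongr; linarith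
    have hC2 : t * (L * z - 2 * δ * L - 1 - K) ≤ t * c2 := by gcongr; linarith
    have hδk : δ * k ≤ δ * (L + 1) := by gcongr
    have hV : t ^ 2 * v ≤ t ^ 2 * (L + δ * L + K + 14) := by gcongr; linarith
    have hT : t * ((1 + 3 * δ) * k) ≤ t * (L + 3 * δ * L + 4) := by gcongr; linarith
    have ht2 : t ^ 2 ≤ 1 := by nlinarith
    have e1 : t * (δ * L) ≤ δ * L := mul_le_of_le_one_left (by positivity) ht1
    have e2 : t ^ 2 * (δ * L) ≤ δ * L := mul_le_of_le_one_left (by positivity) ht2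
    have e3 : t * K ≤ K := mul_le_of_le_one_left hK ht1
    have e4 : t ^ 2 * K ≤ K := mul_le_of_le_one_left hK ht2
    have hvδ : δ * regNegLog (H + H) (Real.exp (-L)) ≤ δ * L := by gcongr
    have hδL : 0 < δ * L := by positivity
    have main : c - t * (c1 + c2) + t ^ 2 * v / 2 + t * ((1 + 3 * δ) * k) ≤
        (1 / 2 + 9 * δ) * L + (4 * K + 13) := by
      linarith
    have hγt : γ * t ≤ γ := mul_le_of_le_one_right hγ.le ht1
    calc _ = γ ^ 2 * (c - t * (c1 + c2) + t ^ 2 * v / 2 + t * ((1 + 3 * δ) * k)) + γ * t := by ring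
      _ ≤ _ := add_le_add (mul_le_mul_of_nonneg_left main (sq_nonneg γ)) hγt
  · have hHL' : regNegLog (H + H) (Real.exp (-L)) ≤ L / 2 := by
      refine (regNegLog_le_inv (by linarith [hH.1]) (Real.exp_pos _).le).trans ?_
      rw [div_le_div_iff₀ (by linarith [hH.1]) (by norm_num)]
      linarith
    have hmono : ∫ ω, wickExp P (γ • X H x) ω * wickExp P (γ • X H y) ω *
        (barrier X e N q (γ * (1 + 3 * δ)) s x ω * barrier X e N q (γ * (1 + 3 * δ)) s y ω) ∂P ≤
        ∫ ω, wickExp P (γ • X H x) ω * wickExp P (γ • X H y) ω ∂P :=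
      integral_mono hFint hYY fun ω => mul_le_of_le_one_right (hpos ω)
        (mul_le_one₀ barrier_le_one barrier_nonneg barrier_le_one)
    refine hmono.trans ?_
    rw [hX.gaussian.integral_wickExp_mul_wickExp hfx hfy, hsm]
    refine Real.exp_le_exp.2 ?_
    have h1 : ∫ ω, X H x ω * X H y ω ∂P ≤ (1 / 2 + 9 * δ) * L + (4 * K + 13) := by
      have := mul_le_mul_of_nonneg_left hHL' (by linarith : 0 ≤ 1 + δ)
      have : 0 < δ * L := by positivity
      linarith
    have := mul_le_mul_of_nonneg_left h1 (sq_nonneg γ)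
    linarith

end IsLogField

/-- The mixed second moment of the normalised exponentials restricted by the barrier. -/
noncomputable def twoPoint {Ω E : Type*} [MeasurableSpace Ω] [AddCommGroup E] [Module ℝ E]
    (P : Measure Ω) (X : ℝ → E → Ω → ℝ) (e : E) (N : ℕ → ℕ) (q : ℕ → ℝ) (γ α : ℝ) (s : Finset ℕ)
    (H h : ℝ) (x y : E) : ℝ :=
  ∫ ω, wickExp P (γ • X H x) ω * wickExp P (γ • X h y) ω *
      (barrier X e N q α s x ω * barrier X e N q α s y ω) ∂P

lemma abs_exp_sub_exp_le {a b c : ℝ} (ha : a ≤ c) (hb : b ≤ c) :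
    |Real.exp a - Real.exp b| ≤ Real.exp c * |a - b| := by
  wlog h : b ≤ a generalizing a b
  · rw [abs_sub_comm, abs_sub_comm a]
    exact this hb ha (le_of_not_ge h)
  rw [abs_of_nonneg (sub_nonneg.2 (Real.exp_le_exp.2 h)), abs_of_nonneg (sub_nonneg.2 h)]
  have h1 : Real.exp a - Real.exp b ≤ Real.exp a * (a - b) := by
    have h2 := Real.add_one_le_exp (b - a)
    have h3 : Real.exp b = Real.exp a * Real.exp (b - a) := by rw [← Real.exp_add]; congr 1; ring
    nlinarith [Real.exp_pos a]
  exact h1.trans (mul_le_mul_of_nonneg_right (Real.exp_le_exp.2 ha) (sub_nonneg.2 h))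

lemma abs_integral_prod_cutoff_sub_le {Ω ι : Type*} [MeasurableSpace Ω] [Fintype ι] {P : Measure Ω}
    [IsProbabilityMeasure P] {V : ι → Ω → ℝ} (hV : ∀ i, Measurable (V i)) (a m m' : ι → ℝ) :
    |∫ ω, ∏ i, cutoff (a i) (V i ω + m i) ∂P - ∫ ω, ∏ i, cutoff (a i) (V i ω + m' i) ∂P| ≤
      ∑ i, |m i - m' i| := by
  have hFint : ∀ m : ι → ℝ, Integrable (fun ω => ∏ i, cutoff (a i) (V i ω + m i)) P := fun m => by
    refine Integrable.of_bound (C := 1) (Finset.measurable_fun_prod _ fun i _ =>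
      (measurable_cutoff _).comp ((hV i).add_const _)).aestronglyMeasurable (ae_of_all _ fun ω => ?_)
    rw [Real.norm_eq_abs, abs_of_nonneg (Finset.prod_nonneg fun _ _ => cutoff_nonneg _ _)]
    exact Finset.prod_le_one (fun _ _ => cutoff_nonneg _ _) fun _ _ => cutoff_le_one _ _
  rw [← integral_sub (hFint m) (hFint m')]
  refine (abs_integral_le_integral_abs).trans ?_
  refine (integral_mono ((hFint m).sub (hFint m')).abs (integrable_const (∑ i, |m i - m' i|))
    fun ω => ?_).trans (by simp)
  refine (abs_prod_sub_prod_le_sum _ (fun _ _ => cutoff_nonneg _ _) (fun _ _ => cutoff_le_one _ _)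
    (fun _ _ => cutoff_nonneg _ _) fun _ _ => cutoff_le_one _ _).trans ?_
  refine Finset.sum_le_sum fun i _ => (abs_cutoff_sub_le _ _ _).trans (le_of_eq ?_)
  rw [add_sub_add_left_eq_sub]

namespace IsLogField

variable {Ω E : Type*} [MeasurableSpace Ω] [NormedAddCommGroup E] [NormedSpace ℝ E]
  {P : Measure Ω} {D : Set E} {X : ℝ → E → Ω → ℝ} {g : E → E → ℝ} {η δ K : ℝ} {e : E} {N : ℕ → ℕ}
  {q : ℕ → ℝ} {κ γ α H h : ℝ} {k₀ k₁ k : ℕ} {s t : Finset ℕ} {x y : E}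

lemma abs_twoPoint_sub_le (hX : IsLogField P D X g η δ K)
    (hF : IsProbeFamily e N q η δ κ k₀) (ht : ∀ k ∈ t, k₀ ≤ k) (hst : s ⊆ t)
    (hx : Metric.ball x κ ⊆ D) (hy : Metric.ball y κ ⊆ D) (hγ : 0 < γ)
    (hH : H ∈ Ioo 0 η) (hh : h ∈ Ioo 0 η) (hxy : Real.exp (-k₀) ≤ ‖x - y‖) :
    |twoPoint P X e N q γ (γ * (1 + 3 * δ)) t H h x y -
      twoPoint P X e N q γ (γ * (1 + 3 * δ)) s H h x y| ≤
      2 * (Real.exp (γ ^ 2 * (2 * k₀ + K) + γ ^ 2 * δ * (2 * (K + 12) + (2 * (k₀ + 1) + K))) *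
        ∑ k ∈ t \ s, Real.exp (-(γ * δ) ^ 2) ^ k) := by
  have hxD : x ∈ D := hx (Metric.mem_ball_self hF.kappa_pos)
  have hyD : y ∈ D := hy (Metric.mem_ball_self hF.kappa_pos)
  have hfx := smul_mem_fieldSpan (X := X) (γ := γ) hH hxD
  have hfy := smul_mem_fieldSpan (X := X) (γ := γ) hh hyD
  have hYY := hX.gaussian.integrable_wickExp_mul_wickExp hfx hfy
  set Y : Ω → ℝ := fun ω => wickExp P (γ • X H x) ω * wickExp P (γ • X h y) ω with hYdef
  have hpos : ∀ ω, 0 ≤ Y ω := fun ω => (mul_pos (wickExp_pos _ _) (wickExp_pos _ _)).le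
  set a := γ * (1 + 3 * δ) with ha
  have hcut : ∀ z, Metric.ball z κ ⊆ D → ∀ k ∈ t \ s, Integrable (fun ω => Y ω *
      (1 - cutoff (a * k) (probe X e k (N k) (q k) z ω))) P := fun z hz k hk => by
    have hk' := ht k (Finset.mem_sdiff.1 hk).1
    refine hYY.mul_bdd (c := 1) (measurable_const.sub
      (measurable_cutoff_probe hX hF hk' hz _)).aestronglyMeasurable (ae_of_all _ fun ω => ?_)
    rw [Real.norm_eq_abs, abs_le]
    constructor <;> linarith [cutoff_nonneg (a * k) (probe X e k (N k) (q k) z ω),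
      cutoff_le_one (a * k) (probe X e k (N k) (q k) z ω)]
  have hpt : ∀ ω, |Y ω * (barrier X e N q a t x ω * barrier X e N q a t y ω) -
      Y ω * (barrier X e N q a s x ω * barrier X e N q a s y ω)| ≤
      ∑ k ∈ t \ s, Y ω * (1 - cutoff (a * k) (probe X e k (N k) (q k) x ω)) +
        ∑ k ∈ t \ s, Y ω * (1 - cutoff (a * k) (probe X e k (N k) (q k) y ω)) := fun ω => by
    rw [← Finset.mul_sum, ← Finset.mul_sum, ← mul_add, ← mul_sub, abs_mul, abs_of_nonneg (hpos ω)]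
    refine mul_le_mul_of_nonneg_left ?_ (hpos ω)
    have h1 := one_sub_barrier_le (X := X) (e := e) (N := N) (q := q) (α := a) (s := t \ s)
      (x := x) (ω := ω)
    have h2 := one_sub_barrier_le (X := X) (e := e) (N := N) (q := q) (α := a) (s := t \ s)
      (x := y) (ω := ω)
    have hb : ∀ z, barrier X e N q a t z ω =
        barrier X e N q a s z ω * barrier X e N q a (t \ s) z ω := fun z => by
      rw [← barrier_union Finset.disjoint_sdiff, Finset.union_sdiff_of_subset hst]
    rw [hb, hb]
    set b₁ := barrier X e N q a s x ω
    set b₂ := barrier X e N q a s y ω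
    set c₁ := barrier X e N q a (t \ s) x ω
    set c₂ := barrier X e N q a (t \ s) y ω
    have i1 : 0 ≤ b₁ := barrier_nonneg
    have i2 : 0 ≤ b₂ := barrier_nonneg
    have i3 : b₁ ≤ 1 := barrier_le_one
    have i4 : b₂ ≤ 1 := barrier_le_one
    have i5 : 0 ≤ c₁ := barrier_nonneg
    have i6 : 0 ≤ c₂ := barrier_nonneg
    have i7 : c₁ ≤ 1 := barrier_le_one
    have i8 : c₂ ≤ 1 := barrier_le_one
    have i9 : b₁ * b₂ ≤ 1 := mul_le_one₀ i3 i2 i4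
    have i10 : c₁ * c₂ ≤ 1 := mul_le_one₀ i7 i6 i8
    have i11 : 1 - c₁ * c₂ ≤ (1 - c₁) + (1 - c₂) := by nlinarith
    calc |b₁ * c₁ * (b₂ * c₂) - b₁ * b₂| = b₁ * b₂ * (1 - c₁ * c₂) := by
          rw [abs_sub_comm, show b₁ * b₂ - b₁ * c₁ * (b₂ * c₂) = b₁ * b₂ * (1 - c₁ * c₂) by ring,
            abs_of_nonneg (mul_nonneg (mul_nonneg i1 i2) (sub_nonneg.2 i10))]
      _ ≤ 1 - c₁ * c₂ := mul_le_of_le_one_left (sub_nonneg.2 i10) i9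
      _ ≤ _ := by linarith
  have hsI : ∀ k ∈ s, k₀ ≤ k := fun k hk => ht k (hst hk)
  have hI1 := integrable_mul_barrier_mul_barrier (α := a) hX hF ht hx hy hYY
  have hI2 := integrable_mul_barrier_mul_barrier (α := a) hX hF hsI hx hy hYY
  rw [twoPoint, twoPoint, ← integral_sub hI1 hI2]
  refine abs_integral_le_integral_abs.trans ((integral_mono (hI1.sub hI2).abs
    ((integrable_finsetSum _ (hcut x hx)).add (integrable_finsetSum _ (hcut y hy))) hpt).trans ?_)
  rw [integral_add' (integrable_finsetSum _ (hcut x hx)) (integrable_finsetSum _ (hcut y hy)),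
    integral_finsetSum _ (hcut x hx), integral_finsetSum _ (hcut y hy), two_mul, Finset.mul_sum]
  refine add_le_add (Finset.sum_le_sum fun k hk => ?_) (Finset.sum_le_sum fun k hk => ?_)
  · exact far_moment_le hX hF (ht k (Finset.mem_sdiff.1 hk).1) hx hγ hH hh hyD hxy
  · have := far_moment_le hX hF (ht k (Finset.mem_sdiff.1 hk).1) hy hγ hh hH hxD
      (by rwa [norm_sub_rev])
    simpa only [hYdef, mul_comm (wickExp P (γ • X H x) _)] using this

/-- The two point function at macroscopic distance is close to a quantity not depending on the
regularisation of the field. -/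
lemma abs_twoPoint_sub_le_of_cov [IsProbabilityMeasure P] (hX : IsLogField P D X g η δ K)
    (hF : IsProbeFamily e N q η δ κ k₀) (hs : ∀ k ∈ s, k₀ ≤ k)
    (hx : Metric.ball x κ ⊆ D) (hy : Metric.ball y κ ⊆ D) (hγ : 0 < γ)
    (hH : H ∈ Ioo 0 η) (hh : h ∈ Ioo 0 η) {l B τ : ℝ} {A : ℕ → E → E → ℝ}
    (hl : |∫ ω, X H x ω * X h y ω ∂P - l| ≤ τ) (hlB : l + τ ≤ B)
    (hA : ∀ k ∈ s, ∀ u ∈ ({x, y} : Set E),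
      |∫ ω, probe X e k (N k) (q k) u ω * X H x ω ∂P - A k u x| ≤ τ ∧
      |∫ ω, probe X e k (N k) (q k) u ω * X h y ω ∂P - A k u y| ≤ τ) :
    |twoPoint P X e N q γ α s H h x y - Real.exp (γ ^ 2 * l) *
      ∫ ω, ∏ i : s × Bool, cutoff (α * (i.1 : ℕ))
        (probe X e i.1 (N i.1) (q i.1) (if i.2 then x else y) ω +
          γ * (A i.1 (if i.2 then x else y) x + A i.1 (if i.2 then x else y) y)) ∂P| ≤
      Real.exp (γ ^ 2 * B) * ((γ ^ 2 + 4 * γ * s.card) * τ) := by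
  have hxD : x ∈ D := hx (Metric.mem_ball_self hF.kappa_pos)
  have hyD : y ∈ D := hy (Metric.mem_ball_self hF.kappa_pos)
  have hfx := smul_mem_fieldSpan (X := X) (γ := γ) hH hxD
  have hfy := smul_mem_fieldSpan (X := X) (γ := γ) hh hyD
  set Z := γ • X H x + γ • X h y with hZdef
  have hZ : Z ∈ fieldSpan X D η := Submodule.add_mem _ hfx hfy
  set pt : s × Bool → E := fun i => if i.2 then x else y with hpt
  have hptb : ∀ i, Metric.ball (pt i) κ ⊆ D := fun i => by
    simp only [hpt]; split_ifs <;> assumption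
  have hptm : ∀ i, pt i ∈ ({x, y} : Set E) := fun i => by
    simp only [hpt]; split_ifs <;> simp
  set V : s × Bool → Ω → ℝ := fun i => probe X e i.1 (N i.1) (q i.1) (pt i) with hVdef
  have hV : ∀ i, V i ∈ fieldSpan X D η := fun i => hF.probe_mem (hs _ i.1.2) (hptb i)
  set m' : s × Bool → ℝ := fun i => γ * (A i.1 (pt i) x + A i.1 (pt i) y) with hm'
  set Φ : (s × Bool → ℝ) → ℝ := fun w => ∏ i : s × Bool, cutoff (α * (i.1 : ℕ)) (w i) with hΦ
  have hΦm : Measurable Φ := Finset.measurable_fun_prod _ fun i _ =>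
    (measurable_cutoff _).comp (measurable_pi_apply i)
  have hbar : ∀ ω, barrier X e N q α s x ω * barrier X e N q α s y ω = Φ fun i => V i ω := fun ω => by
    simp only [hΦ, hVdef, hpt, Fintype.prod_prod_type, Fintype.prod_bool, barrier]
    rw [← Finset.prod_coe_sort s, ← Finset.prod_coe_sort s, ← Finset.prod_mul_distrib]
    simp
  have hQ : twoPoint P X e N q γ α s H h x y =
      Real.exp (γ ^ 2 * ∫ ω, X H x ω * X h y ω ∂P) *
        ∫ ω, Φ (fun i => V i ω + ∫ ω', Z ω' * V i ω' ∂P) ∂P := by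
    rw [← hX.gaussian.integral_exp_mul_comp hV hZ hΦm, ← integral_const_mul, twoPoint]
    refine integral_congr_ae (ae_of_all _ fun ω => ?_)
    simp only
    rw [hX.gaussian.wickExp_mul_wickExp hfx hfy, hbar,
      IsCenteredGaussianSpace.integral_smul_mul_smul, mul_assoc, wickExp]
  have hm : ∀ i, |∫ ω', Z ω' * V i ω' ∂P - m' i| ≤ 2 * γ * τ := fun i => by
    obtain ⟨h1, h2⟩ := hA i.1 i.1.2 (pt i) (hptm i)
    rw [hZdef, hX.gaussian.integral_add_mul hfx hfy (hV i),
      IsCenteredGaussianSpace.integral_smul_mul, IsCenteredGaussianSpace.integral_smul_mul,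
      IsCenteredGaussianSpace.integral_mul_symm, IsCenteredGaussianSpace.integral_mul_symm (X h y),
      hm']
    simp only [hVdef]
    rw [← mul_add, ← mul_sub, abs_mul, abs_of_pos hγ, add_sub_add_comm]
    have := (abs_add_le _ _).trans (add_le_add h1 h2)
    nlinarith
  have hτ : 0 ≤ τ := (abs_nonneg _).trans hl
  have hdiff := abs_integral_prod_cutoff_sub_le (P := P) (fun i => (hX.gaussian _ (hV i)).1)
    (fun i : s × Bool => α * (i.1 : ℕ)) (fun i => ∫ ω', Z ω' * V i ω' ∂P) m'
  have hsum : ∑ i, |∫ ω', Z ω' * V i ω' ∂P - m' i| ≤ 4 * γ * s.card * τ := by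
    refine (Finset.sum_le_sum fun i _ => hm i).trans (le_of_eq ?_)
    rw [Finset.sum_const, Finset.card_univ, Fintype.card_prod, Fintype.card_coe, Fintype.card_bool,
      nsmul_eq_mul]
    push_cast
    ring
  have hexp := abs_exp_sub_exp_le (a := γ ^ 2 * ∫ ω, X H x ω * X h y ω ∂P) (b := γ ^ 2 * l)
    (c := γ ^ 2 * B) (mul_le_mul_of_nonneg_left (by linarith [(abs_le.1 hl).2]) (sq_nonneg γ))
    (mul_le_mul_of_nonneg_left (by linarith) (sq_nonneg γ))
  have hexp' : Real.exp (γ ^ 2 * l) ≤ Real.exp (γ ^ 2 * B) :=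
    Real.exp_le_exp.2 (mul_le_mul_of_nonneg_left (by linarith) (sq_nonneg γ))
  have hΦ1 : |∫ ω, Φ (fun i => V i ω + ∫ ω', Z ω' * V i ω' ∂P) ∂P| ≤ 1 := by
    have h := norm_integral_le_of_norm_le_const (μ := P) (C := 1)
      (f := fun ω => Φ (fun i => V i ω + ∫ ω', Z ω' * V i ω' ∂P)) (ae_of_all _ fun ω => ?_)
    · simpa using h
    · rw [Real.norm_eq_abs, abs_of_nonneg (Finset.prod_nonneg fun _ _ => cutoff_nonneg _ _)]
      exact Finset.prod_le_one (fun _ _ => cutoff_nonneg _ _) fun _ _ => cutoff_le_one _ _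
  rw [hQ]
  set a := ∫ ω, Φ (fun i => V i ω + ∫ ω', Z ω' * V i ω' ∂P) ∂P
  set b := ∫ ω, Φ (fun i => V i ω + m' i) ∂P
  set c := ∫ ω, X H x ω * X h y ω ∂P
  change |Real.exp (γ ^ 2 * c) * a - Real.exp (γ ^ 2 * l) * b| ≤ _
  have hab : |a - b| ≤ 4 * γ * s.card * τ := hdiff.trans hsum
  calc |Real.exp (γ ^ 2 * c) * a - Real.exp (γ ^ 2 * l) * b|
      = |(Real.exp (γ ^ 2 * c) - Real.exp (γ ^ 2 * l)) * a + Real.exp (γ ^ 2 * l) * (a - b)| := by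
        congr 1; ring
    _ ≤ |Real.exp (γ ^ 2 * c) - Real.exp (γ ^ 2 * l)| * |a| + Real.exp (γ ^ 2 * l) * |a - b| := by
        refine (abs_add_le _ _).trans ?_
        rw [abs_mul, abs_mul, abs_of_pos (Real.exp_pos _)]
    _ ≤ (Real.exp (γ ^ 2 * B) * (γ ^ 2 * τ)) * 1 + Real.exp (γ ^ 2 * B) * (4 * γ * s.card * τ) := by
        gcongr
        refine hexp.trans ?_
        gcongr
        rw [← mul_sub, abs_mul, abs_of_nonneg (sq_nonneg γ)]
        gcongr
    _ = _ := by ring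

lemma exists_abs_twoPoint_sub_le [IsProbabilityMeasure P] (hX : IsLogField P D X g η δ K)
    (hγ : 0 < γ) (α : ℝ) (k₀ k₁ : ℕ) {ε : ℝ} (hε : 0 < ε) :
    ∃ η' > 0, ∀ (e : E) (N : ℕ → ℕ) (q : ℕ → ℝ) (κ : ℝ), IsProbeFamily e N q η δ κ k₀ →
      (∀ k, q k < η') → ∀ x y, Metric.ball x κ ⊆ D → Metric.ball y κ ⊆ D →
      Real.exp (-k₀) ≤ ‖x - y‖ → ∃ R : ℝ, ∀ H ∈ Ioo 0 η, ∀ h ∈ Ioo 0 η, H < η' → h < η' →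
        |twoPoint P X e N q γ α (Finset.Ico k₀ k₁) H h x y - R| ≤ ε := by
  set B : ℝ := 2 * k₀ + K + 2
  set c : ℝ := Real.exp (γ ^ 2 * B) * (γ ^ 2 + 4 * γ * (Finset.Ico k₀ k₁).card)
  have hc : 0 < c := by positivity
  set τ := min 1 (ε / c)
  have hτ : 0 < τ := by positivity
  obtain ⟨η', hη', hlim⟩ := hX.cov_tendsto
    (min (Real.exp (-k₀) / 2) (Real.exp (-k₁) / 8)) (by positivity) τ hτ
  refine ⟨η', hη', fun e N q κ hF hq x y hx hy hxy => ?_⟩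
  have hxD : x ∈ D := hx (Metric.mem_ball_self hF.kappa_pos)
  have hyD : y ∈ D := hy (Metric.mem_ball_self hF.kappa_pos)
  have hpos := Real.exp_pos (-(k₀ : ℝ))
  have hoff : ∀ k ∈ Finset.Ico k₀ k₁, ∀ i < N k, ∀ u ∈ ({x, y} : Set E), ∀ v ∈ ({x, y} : Set E),
      min (Real.exp (-k₀) / 2) (Real.exp (-k₁) / 8) ≤ ‖u + probeOffset e k (N k) i - v‖ := by
    intro k hk i hi u hu v hv
    obtain ⟨hk1, hk2⟩ := Finset.mem_Ico.1 hk
    by_cases huv : u = v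
    · subst huv
      rw [add_sub_cancel_left]
      refine (min_le_right _ _).trans (le_trans ?_ (le_norm_probeOffset hF.norm_eq hi))
      gcongr
    · refine (min_le_left _ _).trans ?_
      have h1 : Real.exp (-k₀) ≤ ‖u - v‖ := by
        rcases hu with rfl | rfl <;> rcases hv with rfl | rfl
        · exact absurd rfl huv
        · exact hxy
        · rwa [norm_sub_rev]
        · exact absurd rfl huv
      have h2 := norm_probeOffset_le (k := k) hF.norm_eq hi
      have h3 : Real.exp (-(k : ℝ)) ≤ Real.exp (-(k₀ : ℝ)) := by gcongr
      have h4 := norm_sub_norm_le (u - v) (-probeOffset e k (N k) i)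
      rw [norm_neg, show u - v - -probeOffset e k (N k) i = u + probeOffset e k (N k) i - v by
        abel] at h4
      linarith
  refine ⟨_, fun H hH h hh hH' hh' => (hX.abs_twoPoint_sub_le_of_cov hF
    (fun k hk => (Finset.mem_Ico.1 hk).1) hx hy hγ hH hh (B := B) (τ := τ)
    (l := -Real.log ‖x - y‖ + g x y) (A := fun k u v => ∑ i ∈ Finset.range (N k), (N k : ℝ)⁻¹ *
      (-Real.log ‖u + probeOffset e k (N k) i - v‖ + g (u + probeOffset e k (N k) i) v))
    ?_ ?_ ?_).trans ?_⟩
  · exact hlim H hH h hh hH' hh' x hxD y hyD ((min_le_left _ _).trans (by linarith))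
  · have h1 := hlim H hH h hh hH' hh' x hxD y hyD ((min_le_left _ _).trans (by linarith))
    have h2 := hX.cov_le_of_exp_neg_le hH hh hxD hyD k₀.cast_nonneg hxy
    have h3 : δ * k₀ ≤ 1 * k₀ := mul_le_mul_of_nonneg_right hX.delta_lt.le k₀.cast_nonneg
    have h4 : τ ≤ 1 := min_le_left _ _
    have := (abs_le.1 h1).1
    simp only [B]
    linarith
  · intro k hk u hu
    have hub : Metric.ball u κ ⊆ D := by rcases hu with rfl | rfl <;> assumption
    have hk' := hF.exp_le k (Finset.mem_Ico.1 hk).1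
    refine ⟨?_, ?_⟩
    · exact hX.abs_probe_cov_sub_le hF.norm_eq (hF.pos k) (hF.mem k) hub hk' hH hxD fun i hi =>
        hlim _ (hF.mem k) H hH (hq k) hH' _ (add_probeOffset_mem hF.norm_eq hub hk' hi) x hxD
          (hoff k hk i hi u hu x (by simp))
    · exact hX.abs_probe_cov_sub_le hF.norm_eq (hF.pos k) (hF.mem k) hub hk' hh hyD fun i hi =>
        hlim _ (hF.mem k) h hh (hq k) hh' _ (add_probeOffset_mem hF.norm_eq hub hk' hi) y hyD
          (hoff k hk i hi u hu y (by simp))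
  · rw [← mul_assoc]
    calc c * τ ≤ c * (ε / c) := mul_le_mul_of_nonneg_left (min_le_right _ _) hc.le
      _ = ε := by field_simp

end IsLogField

section RandomIntegral

variable {E Ω : Type*} [MeasurableSpace E] [MeasurableSpace Ω] {μ : Measure E} {P : Measure Ω}

lemma integrable_prod_of_moment_le [IsFiniteMeasure μ] [SFinite P] {F : E → Ω → ℝ} {c : ℝ}
    (hF : Measurable (Function.uncurry F)) (hFint : ∀ᵐ x ∂μ, Integrable (F x) P)
    (hc : ∀ᵐ x ∂μ, ∫ ω, |F x ω| ∂P ≤ c) : Integrable (Function.uncurry F) (μ.prod P) := by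
  refine (integrable_prod_iff hF.aestronglyMeasurable).2 ⟨hFint, ?_⟩
  refine Integrable.mono' (integrable_const c)
    hF.stronglyMeasurable.norm.integral_prod_right.aestronglyMeasurable ?_
  filter_upwards [hc] with x hx
  rw [Real.norm_eq_abs, abs_of_nonneg (integral_nonneg fun _ => norm_nonneg _)]
  exact hx

lemma integral_abs_integral_le [IsFiniteMeasure μ] [SFinite P] {F : E → Ω → ℝ} {c : ℝ}
    (hF : Measurable (Function.uncurry F)) (hFint : ∀ᵐ x ∂μ, Integrable (F x) P)
    (hc : ∀ᵐ x ∂μ, ∫ ω, |F x ω| ∂P ≤ c) :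
    ∫ ω, |∫ x, F x ω ∂μ| ∂P ≤ μ.real univ * c := by
  have h := integrable_prod_of_moment_le hF hFint hc
  calc ∫ ω, |∫ x, F x ω ∂μ| ∂P ≤ ∫ ω, ∫ x, |F x ω| ∂μ ∂P :=
        integral_mono h.integral_prod_right.abs h.abs.integral_prod_right
          fun ω => abs_integral_le_integral_abs
    _ = ∫ x, ∫ ω, |F x ω| ∂P ∂μ := (integral_integral_swap h.abs).symm
    _ ≤ ∫ _, c ∂μ := integral_mono_ae h.abs.integral_prod_left (integrable_const c) hc
    _ = μ.real univ * c := by simp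

lemma sq_integral_abs_integral_le [IsFiniteMeasure μ] [IsProbabilityMeasure P] {F : E → Ω → ℝ}
    {c : ℝ} (hF : Measurable (Function.uncurry F))
    (hFint : ∀ᵐ x ∂μ, Integrable (fun ω => F x ω ^ 2) P)
    (hc : ∀ᵐ x ∂μ, ∫ ω, F x ω ^ 2 ∂P ≤ c) :
    Integrable (fun z : E × E => ∫ ω, F z.1 ω * F z.2 ω ∂P) (μ.prod μ) ∧
    (∫ ω, |∫ x, F x ω ∂μ| ∂P) ^ 2 ≤ ∫ z, ∫ ω, F z.1 ω * F z.2 ω ∂P ∂(μ.prod μ) := by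
  have hm : ∀ x, Measurable (F x) := fun x => hF.comp measurable_prodMk_left
  have hΦ : Measurable (Function.uncurry fun (z : E × E) ω => F z.1 ω * F z.2 ω) :=
    (hF.comp ((measurable_fst.comp measurable_fst).prodMk measurable_snd)).mul
      (hF.comp ((measurable_snd.comp measurable_fst).prodMk measurable_snd))
  have hae : ∀ᵐ z ∂(μ.prod μ), (Integrable (fun ω => F z.1 ω ^ 2) P ∧ ∫ ω, F z.1 ω ^ 2 ∂P ≤ c) ∧
      (Integrable (fun ω => F z.2 ω ^ 2) P ∧ ∫ ω, F z.2 ω ^ 2 ∂P ≤ c) :=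
    (Measure.quasiMeasurePreserving_fst.ae (hFint.and hc)).and
      (Measure.quasiMeasurePreserving_snd.ae (hFint.and hc))
  have hle : ∀ a b : ℝ, |a * b| ≤ a ^ 2 + b ^ 2 := fun a b => by
    rw [abs_le]; constructor <;> nlinarith [sq_nonneg (a + b), sq_nonneg (a - b)]
  have hΦint : ∀ᵐ z ∂(μ.prod μ), Integrable (fun ω => F z.1 ω * F z.2 ω) P := by
    filter_upwards [hae] with z hz
    exact (hz.1.1.add hz.2.1).mono' ((hm _).mul (hm _)).aestronglyMeasurable
      (ae_of_all _ fun ω => hle _ _)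
  have hprod := integrable_prod_of_moment_le (c := c + c) hΦ hΦint (by
    filter_upwards [hae, hΦint] with z hz hz'
    refine (integral_mono hz'.abs (hz.1.1.add hz.2.1) fun ω => hle _ _).trans ?_
    rw [integral_add' hz.1.1 hz.2.1]
    exact add_le_add hz.1.2 hz.2.2)
  refine ⟨hprod.integral_prod_left, ?_⟩
  set W : Ω → ℝ := fun ω => ∫ x, F x ω ∂μ with hW
  have hWm : Measurable W := hF.stronglyMeasurable.integral_prod_left.measurable
  have hsq : ∀ ω, ∫ z, F z.1 ω * F z.2 ω ∂(μ.prod μ) = W ω ^ 2 := fun ω => by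
    rw [integral_prod_mul (fun x => F x ω) fun x => F x ω, sq]
  have hWsq : Integrable (fun ω => W ω ^ 2) P := by
    simpa only [Function.uncurry, hsq] using hprod.integral_prod_right
  rw [integral_integral_swap hprod]
  simp_rw [hsq]
  have hWabs : Integrable (fun ω => |W ω|) P := by
    refine ((integrable_const (1 : ℝ)).add hWsq).mono' hWm.abs.aestronglyMeasurable
      (ae_of_all _ fun ω => ?_)
    rw [Real.norm_eq_abs, abs_abs, Pi.add_apply, ← sq_abs (W ω)]
    nlinarith [sq_nonneg (|W ω| - 1 / 2)]
  have h0 : 0 ≤ ∫ ω, (W ω ^ 2 - 2 * (∫ ω, |W ω| ∂P) * |W ω| + (∫ ω, |W ω| ∂P) ^ 2) ∂P :=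
    integral_nonneg fun ω => by
      have : (0 : ℝ) ≤ (|W ω| - ∫ ω, |W ω| ∂P) ^ 2 := sq_nonneg _
      rw [sub_sq, sq_abs] at this
      simp only [Pi.zero_apply]
      linarith
  rw [integral_add (f := fun ω => W ω ^ 2 - 2 * (∫ ω, |W ω| ∂P) * |W ω|)
      (hWsq.sub (hWabs.const_mul _)) (integrable_const _), integral_sub hWsq (hWabs.const_mul _),
      integral_const_mul, integral_const, probReal_univ,
    one_smul] at h0
  linarith

end RandomIntegral

section NearDiagonal

variable {E : Type*} [NormedAddCommGroup E] [NormedSpace ℝ E] [FiniteDimensional ℝ E]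
  [MeasurableSpace E] [BorelSpace E]

lemma integrableOn_norm_rpow_neg [Nontrivial E] (μ : Measure E) [μ.IsAddHaarMeasure] {β : ℝ}
    (hβ : β < Module.finrank ℝ E) :
    IntegrableOn (fun z : E => ‖z‖ ^ (-β)) (Metric.ball 0 1) μ := by
  refine (integrableOn_fun_norm_addHaar μ (f := fun r : ℝ => r ^ (-β))).2 ?_
  have h1 : IntegrableOn (fun r : ℝ => r ^ ((Module.finrank ℝ E : ℝ) - 1 - β)) (Ioo 0 1) :=
    (intervalIntegral.integrableOn_Ioo_rpow_iff zero_lt_one).2 (by linarith)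
  refine h1.congr_fun (fun r hr => ?_) measurableSet_Ioo
  have h2 : ((Module.finrank ℝ E - 1 : ℕ) : ℝ) = (Module.finrank ℝ E : ℝ) - 1 := by
    rw [Nat.cast_sub (Nat.one_le_iff_ne_zero.2 Module.finrank_pos.ne'), Nat.cast_one]
  simp only [smul_eq_mul]
  rw [← Real.rpow_natCast, ← Real.rpow_add hr.1, h2]
  congr 1

lemma exists_setIntegral_norm_rpow_neg_le [Nontrivial E] (μ : Measure E) [μ.IsAddHaarMeasure]
    {β ε : ℝ} (hβ : β < Module.finrank ℝ E) (hε : 0 < ε) :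
    ∃ ρ₀ > 0, ∀ ρ ≤ ρ₀, IntegrableOn (fun z : E => ‖z‖ ^ (-β)) (Metric.ball 0 ρ) μ ∧
      ∫ z in Metric.ball (0 : E) ρ, ‖z‖ ^ (-β) ∂μ ≤ ε := by
  have hFint := integrableOn_norm_rpow_neg μ hβ
  have hvol : Tendsto (fun ρ => μ (Metric.ball (0 : E) ρ)) (nhdsWithin 0 (Ioi 0)) (nhds 0) := by
    have h : Tendsto (fun ρ : ℝ => ENNReal.ofReal (ρ ^ Module.finrank ℝ E) * μ (Metric.ball 0 1))
        (nhds 0) (nhds 0) := by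
      have h1 : Tendsto (fun ρ : ℝ => ENNReal.ofReal (ρ ^ Module.finrank ℝ E)) (nhds 0) (nhds 0) := by
        have : Continuous fun ρ : ℝ => ENNReal.ofReal (ρ ^ Module.finrank ℝ E) :=
          ENNReal.continuous_ofReal.comp (continuous_pow _)
        simpa [Module.finrank_pos.ne'] using this.tendsto 0
      simpa using ENNReal.Tendsto.mul_const h1 (Or.inr measure_ball_lt_top.ne)
    refine (h.mono_left nhdsWithin_le_nhds).congr' ?_
    filter_upwards [self_mem_nhdsWithin] with ρ hρ
    rw [Measure.addHaar_ball_of_pos μ 0 hρ]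
  have hlim : Tendsto (fun ρ => ∫ z in Metric.ball (0 : E) ρ, ‖z‖ ^ (-β)
      ∂(μ.restrict (Metric.ball 0 1))) (nhdsWithin 0 (Ioi 0)) (nhds 0) := by
    refine hFint.tendsto_setIntegral_nhds_zero ?_
    exact tendsto_of_tendsto_of_tendsto_of_le_of_le tendsto_const_nhds hvol (fun _ => zero_le)
      fun ρ => Measure.restrict_apply_le _ _
  obtain ⟨ρ₀, hle, hρ₀⟩ := ((hlim.eventually (eventually_le_nhds hε)).and
    (Ioo_mem_nhdsGT zero_lt_one)).exists
  have hsub : Metric.ball (0 : E) ρ₀ ⊆ Metric.ball 0 1 := Metric.ball_subset_ball hρ₀.2.le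
  rw [Measure.restrict_restrict measurableSet_ball, inter_eq_left.2 hsub] at hle
  refine ⟨ρ₀, hρ₀.1, fun ρ hρ => ⟨hFint.mono_set ((Metric.ball_subset_ball hρ).trans hsub), ?_⟩⟩
  exact (setIntegral_mono_set (hFint.mono_set hsub)
    (ae_of_all _ fun z => Real.rpow_nonneg (norm_nonneg _) _)
    (Metric.ball_subset_ball hρ).eventuallyLE).trans hle

lemma integral_prod_le_of_near_far {μ : Measure E} [μ.IsAddHaarMeasure] [Nontrivial E] {S : Set E}
    (hS : MeasurableSet S) (hSfin : μ S ≠ ⊤) {R : E × E → ℝ}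
    (hR : Integrable R ((μ.restrict S).prod (μ.restrict S))) {b c ρ β : ℝ} (hc : 0 ≤ c)
    (hb : 0 ≤ b) (hFint : IntegrableOn (fun z : E => ‖z‖ ^ (-β)) (Metric.ball 0 ρ) μ)
    (hfar : ∀ x ∈ S, ∀ y ∈ S, ρ ≤ ‖x - y‖ → R (x, y) ≤ b)
    (hnear : ∀ x ∈ S, ∀ y ∈ S, x ≠ y → ‖x - y‖ < ρ → R (x, y) ≤ c * ‖x - y‖ ^ (-β)) :
    ∫ z, R z ∂((μ.restrict S).prod (μ.restrict S)) ≤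
      μ.real S * (μ.real S * b + c * ∫ z in Metric.ball (0 : E) ρ, ‖z‖ ^ (-β) ∂μ) := by
  have : IsFiniteMeasure (μ.restrict S) := ⟨by simpa using hSfin.lt_top⟩
  set φ : E → ℝ := (Metric.ball (0 : E) ρ).indicator fun z => ‖z‖ ^ (-β) with hφ
  have hφint : Integrable φ μ := (integrable_indicator_iff measurableSet_ball).2 hFint
  have hφ0 : ∀ z, 0 ≤ φ z := indicator_nonneg fun z _ => Real.rpow_nonneg (norm_nonneg _) _
  rw [integral_prod _ hR]
  have hinner : ∀ᵐ x ∂μ.restrict S, ∫ y, R (x, y) ∂μ.restrict S ≤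
      μ.real S * b + c * ∫ z in Metric.ball (0 : E) ρ, ‖z‖ ^ (-β) ∂μ := by
    filter_upwards [hR.prod_right_ae, ae_restrict_mem hS] with x hx hxS
    have hφx : Integrable (fun y => φ (x - y)) μ := hφint.comp_sub_left x
    calc ∫ y, R (x, y) ∂μ.restrict S ≤ ∫ y, (b + c * φ (x - y)) ∂μ.restrict S := by
          refine integral_mono_ae hx ((integrable_const b).add (hφx.restrict.const_mul c)) ?_
          filter_upwards [ae_restrict_mem hS, ae_restrict_of_ae (Measure.ae_ne μ x)] with y hyS hyx
          by_cases h : ρ ≤ ‖x - y‖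
          · exact (hfar x hxS y hyS h).trans (le_add_of_nonneg_right (mul_nonneg hc (hφ0 _)))
          · have hmem : x - y ∈ Metric.ball (0 : E) ρ := by simpa using h
            have := hnear x hxS y hyS hyx.symm (not_le.1 h)
            simp only [hφ, indicator_of_mem hmem]
            linarith
      _ = μ.real S * b + c * ∫ y, φ (x - y) ∂μ.restrict S := by
          rw [integral_add (integrable_const b) (hφx.restrict.const_mul c), integral_const_mul]
          simp
      _ ≤ μ.real S * b + c * ∫ y, φ (x - y) ∂μ := by
          have := setIntegral_le_integral (s := S) hφx (ae_of_all _ fun y => hφ0 _)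
          gcongr
      _ = μ.real S * b + c * ∫ z in Metric.ball (0 : E) ρ, ‖z‖ ^ (-β) ∂μ := by
          rw [integral_sub_left_eq_self φ μ x, integral_indicator measurableSet_ball]
  refine (integral_mono_ae hR.integral_prod_left (integrable_const _) hinner).trans ?_
  simp

end NearDiagonal

lemma measurable_uncurry_wickExp {Ω E : Type*} [MeasurableSpace Ω] [MeasurableSpace E]
    {P : Measure Ω} [SFinite P] {f : E → Ω → ℝ} (hf : Measurable (Function.uncurry f)) :
    Measurable (Function.uncurry fun x ω => wickExp P (f x) ω) := by
  have h : Measurable fun x => ∫ ω, f x ω * f x ω ∂P :=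
    (hf.mul hf).stronglyMeasurable.integral_prod_right.measurable
  exact (hf.sub ((h.comp measurable_fst).div_const 2)).exp

lemma measurable_uncurry_wickExp_smul {Ω E : Type*} [MeasurableSpace Ω] [MeasurableSpace E]
    {P : Measure Ω} [SFinite P] {f : E → Ω → ℝ} (hf : Measurable (Function.uncurry f)) (γ : ℝ) :
    Measurable (Function.uncurry fun x ω => wickExp P (γ • f x) ω) :=
  measurable_uncurry_wickExp (f := fun x => γ • f x) (hf.const_smul γ)

lemma measurable_uncurry_barrier {Ω E : Type*} [MeasurableSpace Ω] [NormedAddCommGroup E]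
    [NormedSpace ℝ E] [MeasurableSpace E] [BorelSpace E] [SecondCountableTopology E]
    {X : ℝ → E → Ω → ℝ} (hXm : ∀ H, Measurable (Function.uncurry (X H)))
    (e : E) (N : ℕ → ℕ) (q : ℕ → ℝ) (α : ℝ) (s : Finset ℕ) :
    Measurable (Function.uncurry fun x ω => barrier X e N q α s x ω) := by
  refine Finset.measurable_fun_prod _ fun k _ => (measurable_cutoff _).comp ?_
  simp only [probe, Finset.sum_apply, Pi.smul_apply]
  refine Finset.measurable_fun_sum _ fun i _ => Measurable.fun_const_smul ?_ _
  exact (hXm (q k)).comp ((measurable_fst.add_const _).prodMk measurable_snd)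

lemma exists_sum_le_of_summable {f : ℕ → ℝ} (hf : Summable f) {ε : ℝ} (hε : 0 < ε) :
    ∃ n : ℕ, ∀ t : Finset ℕ, (∀ k ∈ t, n ≤ k) → ∑ k ∈ t, f k ≤ ε := by
  obtain ⟨s, hs⟩ := summable_iff_vanishing_norm.1 hf ε hε
  refine ⟨s.sup id + 1, fun t ht => (le_abs_self _).trans (hs t ?_).le⟩
  refine Finset.disjoint_left.2 fun k hk hks => ?_
  have h1 := ht k hk
  have h2 : k ≤ s.sup id := Finset.le_sup (f := id) hks
  omega

namespace IsLogField

section TwoPoint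

variable {Ω E : Type*} [MeasurableSpace Ω] [NormedAddCommGroup E] [NormedSpace ℝ E]
  {P : Measure Ω} {D : Set E} {X : ℝ → E → Ω → ℝ} {g : E → E → ℝ} {η δ K : ℝ} {e : E} {N : ℕ → ℕ}
  {q : ℕ → ℝ} {κ γ α H h : ℝ} {k₀ k₁ : ℕ} {s t : Finset ℕ} {x y : E}

lemma twoPoint_nonneg : 0 ≤ twoPoint P X e N q γ α s H h x y :=
  integral_nonneg fun _ => mul_nonneg (mul_nonneg (wickExp_pos _ _).le (wickExp_pos _ _).le)
    (mul_nonneg barrier_nonneg barrier_nonneg)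

lemma integrable_twoPoint (hX : IsLogField P D X g η δ K)
    (hF : IsProbeFamily e N q η δ κ k₀) (hs : ∀ k ∈ s, k₀ ≤ k) (hx : Metric.ball x κ ⊆ D)
    (hy : Metric.ball y κ ⊆ D) (hH : H ∈ Ioo 0 η) (hh : h ∈ Ioo 0 η) :
    Integrable (fun ω => wickExp P (γ • X H x) ω * wickExp P (γ • X h y) ω *
      (barrier X e N q α s x ω * barrier X e N q α s y ω)) P :=
  hX.integrable_mul_barrier_mul_barrier hF hs hx hy (hX.gaussian.integrable_wickExp_mul_wickExp
    (smul_mem_fieldSpan hH (hx (Metric.mem_ball_self hF.kappa_pos)))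
    (smul_mem_fieldSpan hh (hy (Metric.mem_ball_self hF.kappa_pos))))

lemma twoPoint_le (hX : IsLogField P D X g η δ K)
    (hF : IsProbeFamily e N q η δ κ k₀) (hs : ∀ k ∈ s, k₀ ≤ k) (hx : Metric.ball x κ ⊆ D)
    (hy : Metric.ball y κ ⊆ D) (hH : H ∈ Ioo 0 η) (hh : h ∈ Ioo 0 η) :
    twoPoint P X e N q γ α s H h x y ≤ Real.exp (γ ^ 2 * ((1 + δ) * (1 / (H + h)) + K)) := by
  have hxD : x ∈ D := hx (Metric.mem_ball_self hF.kappa_pos)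
  have hyD : y ∈ D := hy (Metric.mem_ball_self hF.kappa_pos)
  have hfx := smul_mem_fieldSpan (X := X) (γ := γ) hH hxD
  have hfy := smul_mem_fieldSpan (X := X) (γ := γ) hh hyD
  have h1 := hX.gaussian.integral_wickExp_mul_wickExp hfx hfy
  rw [IsCenteredGaussianSpace.integral_smul_mul_smul] at h1
  refine (integral_mono (hX.integrable_twoPoint hF hs hx hy hH hh)
    (hX.gaussian.integrable_wickExp_mul_wickExp hfx hfy) fun ω => ?_).trans (h1.le.trans ?_)
  · exact mul_le_of_le_one_right (mul_pos (wickExp_pos _ _) (wickExp_pos _ _)).le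
      (mul_le_one₀ barrier_le_one barrier_nonneg barrier_le_one)
  · have := hX.cov_le_inv hH hh hxD hyD
    gcongr

lemma integral_sub_mul_sub_barrier (hX : IsLogField P D X g η δ K)
    (hF : IsProbeFamily e N q η δ κ k₀) (hs : ∀ k ∈ s, k₀ ≤ k) (hx : Metric.ball x κ ⊆ D)
    (hy : Metric.ball y κ ⊆ D) (hH : H ∈ Ioo 0 η) (hh : h ∈ Ioo 0 η) :
    Integrable (fun ω =>
      ((wickExp P (γ • X H x) ω - wickExp P (γ • X h x) ω) * barrier X e N q α s x ω) *
      ((wickExp P (γ • X H y) ω - wickExp P (γ • X h y) ω) * barrier X e N q α s y ω)) P ∧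
    ∫ ω, ((wickExp P (γ • X H x) ω - wickExp P (γ • X h x) ω) * barrier X e N q α s x ω) *
      ((wickExp P (γ • X H y) ω - wickExp P (γ • X h y) ω) * barrier X e N q α s y ω) ∂P =
      (twoPoint P X e N q γ α s H H x y + twoPoint P X e N q γ α s h h x y) -
      (twoPoint P X e N q γ α s H h x y + twoPoint P X e N q γ α s h H x y) := by
  have i1 := hX.integrable_twoPoint (γ := γ) (α := α) hF hs hx hy hH hH
  have i2 := hX.integrable_twoPoint (γ := γ) (α := α) hF hs hx hy hh hh
  have i3 := hX.integrable_twoPoint (γ := γ) (α := α) hF hs hx hy hH hh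
  have i4 := hX.integrable_twoPoint (γ := γ) (α := α) hF hs hx hy hh hH
  have heq : ∀ ω,
      ((wickExp P (γ • X H x) ω - wickExp P (γ • X h x) ω) * barrier X e N q α s x ω) *
      ((wickExp P (γ • X H y) ω - wickExp P (γ • X h y) ω) * barrier X e N q α s y ω) =
      (wickExp P (γ • X H x) ω * wickExp P (γ • X H y) ω *
        (barrier X e N q α s x ω * barrier X e N q α s y ω) +
      wickExp P (γ • X h x) ω * wickExp P (γ • X h y) ω *
        (barrier X e N q α s x ω * barrier X e N q α s y ω)) -
      (wickExp P (γ • X H x) ω * wickExp P (γ • X h y) ω *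
        (barrier X e N q α s x ω * barrier X e N q α s y ω) +
      wickExp P (γ • X h x) ω * wickExp P (γ • X H y) ω *
        (barrier X e N q α s x ω * barrier X e N q α s y ω)) := fun ω => by ring
  simp_rw [heq]
  exact ⟨(i1.add i2).sub (i3.add i4), (integral_sub (i1.add i2) (i3.add i4)).trans
    (congr_arg₂ _ (integral_add i1 i2) (integral_add i3 i4))⟩

lemma twoPoint_near_le (hX : IsLogField P D X g η δ K)
    (hF : IsProbeFamily e N q η δ κ k₀) (hx : Metric.ball x κ ⊆ D)
    (hy : Metric.ball y κ ⊆ D) (hγ : 0 < γ) (hH : H ∈ Ioo 0 η) (hxy : x ≠ y)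
    (hlt : ‖x - y‖ < Real.exp (-k₀)) (hk₁ : ⌈1 / H⌉₊ + 1 ≤ k₁) :
    twoPoint P X e N q γ (γ * (1 + 3 * δ)) (Finset.Ico k₀ k₁) H H x y ≤
      Real.exp (γ ^ 2 * (4 * K + 13) + γ) * ‖x - y‖ ^ (-(γ ^ 2 * (1 / 2 + 9 * δ))) := by
  have hr : 0 < ‖x - y‖ := norm_pos_iff.2 (sub_ne_zero.2 hxy)
  set L : ℝ := -Real.log ‖x - y‖ with hL
  have hrL : ‖x - y‖ = Real.exp (-L) := by rw [hL, neg_neg, Real.exp_log hr]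
  have hkL : (k₀ : ℝ) < L := by
    rw [hrL, Real.exp_lt_exp] at hlt; linarith
  have hL0 : 0 < L := (Nat.cast_nonneg k₀).trans_lt hkL
  have hor : ⌈L⌉₊ ∈ Finset.Ico k₀ k₁ ∨ 1 ≤ H * L := by
    by_cases hc : ⌈L⌉₊ < k₁
    · refine Or.inl (Finset.mem_Ico.2 ⟨?_, hc⟩)
      exact_mod_cast hkL.le.trans (Nat.le_ceil L)
    · right
      have h1 : ((⌈1 / H⌉₊ + 1 : ℕ) : ℝ) ≤ ⌈L⌉₊ := by exact_mod_cast hk₁.trans (not_lt.1 hc)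
      have h2 := Nat.ceil_lt_add_one hL0.le
      have h3 := Nat.le_ceil (1 / H)
      push_cast at h1
      have h4 : 1 / H ≤ L := by linarith
      rwa [div_le_iff₀' hH.1] at h4
  refine (hX.near_moment_le hF (fun k hk => (Finset.mem_Ico.1 hk).1) hx hy hγ hH hL0 hrL hor).trans
    (le_of_eq ?_)
  rw [Real.rpow_def_of_pos hr, ← Real.exp_add, hL]
  congr 1
  ring

end TwoPoint

lemma integrable_prod_wickExp {Ω E : Type*} [MeasurableSpace Ω] [NormedAddCommGroup E]
    [MeasurableSpace E] {P : Measure Ω} [IsProbabilityMeasure P] {μ : Measure E} {S D : Set E}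
    {X : ℝ → E → Ω → ℝ} {g : E → E → ℝ} {η δ K γ H : ℝ} (hX : IsLogField P D X g η δ K)
    (hXm : ∀ H, Measurable (Function.uncurry (X H))) (hS : MeasurableSet S) (hSfin : μ S ≠ ⊤)
    (hSD : S ⊆ D) (hH : H ∈ Ioo 0 η) :
    Integrable (Function.uncurry fun x ω => wickExp P (γ • X H x) ω) ((μ.restrict S).prod P) := by
  have : IsFiniteMeasure (μ.restrict S) := ⟨by simpa using hSfin.lt_top⟩
  refine integrable_prod_of_moment_le (c := 1) (measurable_uncurry_wickExp_smul (hXm H) γ) ?_ ?_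
  · filter_upwards [ae_restrict_mem hS] with x hx
    exact hX.gaussian.integrable_wickExp (smul_mem_fieldSpan hH (hSD hx))
  · filter_upwards [ae_restrict_mem hS] with x hx
    simp_rw [abs_of_pos (wickExp_pos _ _)]
    exact (hX.gaussian.integral_wickExp (smul_mem_fieldSpan hH (hSD hx))).le

section Mass

variable {Ω E : Type*} [MeasurableSpace Ω] [NormedAddCommGroup E] [NormedSpace ℝ E]
  [FiniteDimensional ℝ E] [MeasurableSpace E] [BorelSpace E] {P : Measure Ω}
  [IsProbabilityMeasure P] {μ : Measure E} {S D : Set E} {X : ℝ → E → Ω → ℝ} {g : E → E → ℝ}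
  {η δ K : ℝ} {e : E} {N : ℕ → ℕ} {q : ℕ → ℝ} {κ γ α H h : ℝ} {k₀ k₁ k₂ : ℕ} {s : Finset ℕ}

lemma integrable_prod_wickExp_mul_barrier (hX : IsLogField P D X g η δ K)
    (hXm : ∀ H, Measurable (Function.uncurry (X H))) (hS : MeasurableSet S) (hSfin : μ S ≠ ⊤)
    (hSD : S ⊆ D) (hH : H ∈ Ioo 0 η) :
    Integrable (Function.uncurry fun x ω => wickExp P (γ • X H x) ω * barrier X e N q α s x ω)
      ((μ.restrict S).prod P) := by
  refine (hX.integrable_prod_wickExp hXm hS hSfin hSD hH).mul_bdd (c := 1)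
    (measurable_uncurry_barrier hXm e N q α s).aestronglyMeasurable (ae_of_all _ fun z => ?_)
  exact abs_le.2 ⟨(neg_nonpos.2 zero_le_one).trans barrier_nonneg, barrier_le_one⟩

lemma integral_abs_sub_barrier_le (hX : IsLogField P D X g η δ K)
    (hXm : ∀ H, Measurable (Function.uncurry (X H)))
    (hF : IsProbeFamily e N q η δ κ k₀) (hs : ∀ k ∈ s, k₀ ≤ k) (hS : MeasurableSet S)
    (hSfin : μ S ≠ ⊤) (hSκ : ∀ x ∈ S, Metric.ball x κ ⊆ D) (hγ : 0 < γ) (hH : H ∈ Ioo 0 η) :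
    ∫ ω, |∫ x in S, wickExp P (γ • X H x) ω ∂μ -
      ∫ x in S, wickExp P (γ • X H x) ω * barrier X e N q (γ * (1 + 3 * δ)) s x ω ∂μ| ∂P ≤
      μ.real S * (Real.exp (γ ^ 2 * δ * (2 * (K + 12))) *
        ∑ k ∈ s, Real.exp (-(γ * δ) ^ 2) ^ k) := by
  have hSD : S ⊆ D := fun x hx => hSκ x hx (Metric.mem_ball_self hF.kappa_pos)
  have : IsFiniteMeasure (μ.restrict S) := ⟨by simpa using hSfin.lt_top⟩
  have i1 := hX.integrable_prod_wickExp (γ := γ) hXm hS hSfin hSD hH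
  have i2 := hX.integrable_prod_wickExp_mul_barrier (γ := γ) (e := e) (N := N) (q := q)
    (α := γ * (1 + 3 * δ)) (s := s) hXm hS hSfin hSD hH
  have hm : Measurable (Function.uncurry fun x ω => wickExp P (γ • X H x) ω -
      wickExp P (γ • X H x) ω * barrier X e N q (γ * (1 + 3 * δ)) s x ω) :=
    have hw := measurable_uncurry_wickExp_smul (P := P) (hXm H) γ
    hw.sub (hw.mul (measurable_uncurry_barrier hXm e N q _ s))
  have hpt : ∀ x ∈ S, Integrable (fun ω => wickExp P (γ • X H x) ω -
      wickExp P (γ • X H x) ω * barrier X e N q (γ * (1 + 3 * δ)) s x ω) P := fun x hx =>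
    (hX.gaussian.integrable_wickExp (smul_mem_fieldSpan hH (hSD hx))).sub
      (hX.integrable_wickExp_mul_barrier hF hs (hSκ x hx) (smul_mem_fieldSpan hH (hSD hx)))
  have hbound := integral_abs_integral_le (μ := μ.restrict S) (P := P)
    (c := Real.exp (γ ^ 2 * δ * (2 * (K + 12))) * ∑ k ∈ s, Real.exp (-(γ * δ) ^ 2) ^ k) hm
    (by filter_upwards [ae_restrict_mem hS] with x hx using hpt x hx) (by
      filter_upwards [ae_restrict_mem hS] with x hx
      have hle : ∀ ω, |wickExp P (γ • X H x) ω -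
          wickExp P (γ • X H x) ω * barrier X e N q (γ * (1 + 3 * δ)) s x ω| ≤
          ∑ k ∈ s, wickExp P (γ • X H x) ω *
            (1 - cutoff (γ * (1 + 3 * δ) * k) (probe X e k (N k) (q k) x ω)) := fun ω => by
        rw [← mul_one_sub, abs_of_nonneg (mul_nonneg (wickExp_pos _ _).le
          (sub_nonneg.2 barrier_le_one)), ← Finset.mul_sum]
        exact mul_le_mul_of_nonneg_left one_sub_barrier_le (wickExp_pos _ _).le
      have hi : ∀ k ∈ s, Integrable (fun ω => wickExp P (γ • X H x) ω *
          (1 - cutoff (γ * (1 + 3 * δ) * k) (probe X e k (N k) (q k) x ω))) P := fun k hk =>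
        hX.integrable_wickExp_mul_one_sub_cutoff hF (hs k hk) (hSκ x hx) _
          (smul_mem_fieldSpan hH (hSD hx))
      refine (integral_mono (hpt x hx).abs (integrable_finsetSum _ hi) hle).trans ?_
      rw [integral_finsetSum _ hi, Finset.mul_sum]
      exact Finset.sum_le_sum fun k hk => hX.bad_moment_le hF (hs k hk) (hSκ x hx) hγ hH)
  rw [measureReal_restrict_apply_univ] at hbound
  refine (integral_mono_ae ?_ ?_ ?_).trans hbound
  · exact (i1.integral_prod_right.sub i2.integral_prod_right).abs
  · exact (i1.sub i2).integral_prod_right.abs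
  · filter_upwards [i1.prod_left_ae, i2.prod_left_ae] with ω h1 h2
    simp only [Function.uncurry_apply_pair] at h1 h2
    rw [integral_sub h1 h2]

lemma sq_integral_abs_barrier_sub_le [Nontrivial E] [μ.IsAddHaarMeasure]
    (hX : IsLogField P D X g η δ K)
    (hXm : ∀ H, Measurable (Function.uncurry (X H)))
    (hF : IsProbeFamily e N q η δ κ k₀) (hS : MeasurableSet S)
    (hSfin : μ S ≠ ⊤) (hSκ : ∀ x ∈ S, Metric.ball x κ ⊆ D) (hγ : 0 < γ) (hH : H ∈ Ioo 0 η)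
    (hh : h ∈ Ioo 0 η) (hk₁ : ⌈1 / H⌉₊ + 1 ≤ k₁) (hk₁' : ⌈1 / h⌉₊ + 1 ≤ k₁) {b : ℝ} (hb : 0 ≤ b)
    (hFint : IntegrableOn (fun z : E => ‖z‖ ^ (-(γ ^ 2 * (1 / 2 + 9 * δ))))
      (Metric.ball 0 (Real.exp (-k₀))) μ)
    (hfar : ∀ x ∈ S, ∀ y ∈ S, Real.exp (-k₀) ≤ ‖x - y‖ → ∃ R : ℝ,
      ∀ H' ∈ ({H, h} : Set ℝ), ∀ h' ∈ ({H, h} : Set ℝ),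
        |twoPoint P X e N q γ (γ * (1 + 3 * δ)) (Finset.Ico k₀ k₁) H' h' x y - R| ≤ b) :
    (∫ ω, |∫ x in S, wickExp P (γ • X H x) ω *
        barrier X e N q (γ * (1 + 3 * δ)) (Finset.Ico k₀ k₁) x ω ∂μ -
      ∫ x in S, wickExp P (γ • X h x) ω *
        barrier X e N q (γ * (1 + 3 * δ)) (Finset.Ico k₀ k₁) x ω ∂μ| ∂P) ^ 2 ≤
      μ.real S * (μ.real S * (4 * b) + 2 * Real.exp (γ ^ 2 * (4 * K + 13) + γ) *
        ∫ z in Metric.ball (0 : E) (Real.exp (-k₀)), ‖z‖ ^ (-(γ ^ 2 * (1 / 2 + 9 * δ))) ∂μ) := by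
  have hSD : S ⊆ D := fun x hx => hSκ x hx (Metric.mem_ball_self hF.kappa_pos)
  have : IsFiniteMeasure (μ.restrict S) := ⟨by simpa using hSfin.lt_top⟩
  have hs : ∀ k ∈ Finset.Ico k₀ k₁, k₀ ≤ k := fun k hk => (Finset.mem_Ico.1 hk).1
  have i1 := hX.integrable_prod_wickExp_mul_barrier (γ := γ) (e := e) (N := N) (q := q)
    (α := γ * (1 + 3 * δ)) (s := Finset.Ico k₀ k₁) hXm hS hSfin hSD hH
  have i2 := hX.integrable_prod_wickExp_mul_barrier (γ := γ) (e := e) (N := N) (q := q)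
    (α := γ * (1 + 3 * δ)) (s := Finset.Ico k₀ k₁) hXm hS hSfin hSD hh
  set F : E → Ω → ℝ := fun x ω => (wickExp P (γ • X H x) ω - wickExp P (γ • X h x) ω) *
    barrier X e N q (γ * (1 + 3 * δ)) (Finset.Ico k₀ k₁) x ω with hFdef
  have hm : Measurable (Function.uncurry F) :=
    ((measurable_uncurry_wickExp_smul (P := P) (hXm H) γ).sub
      (measurable_uncurry_wickExp_smul (P := P) (hXm h) γ)).mul
        (measurable_uncurry_barrier hXm e N q _ _)
  have hFF := fun x (hx : x ∈ S) y (hy : y ∈ S) =>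
    hX.integral_sub_mul_sub_barrier (γ := γ) (α := γ * (1 + 3 * δ)) hF hs
      (hSκ x hx) (hSκ y hy) hH hh
  have hcov : ∀ x ∈ S, ∀ y ∈ S, ∫ ω, F x ω * F y ω ∂P ≤
      twoPoint P X e N q γ (γ * (1 + 3 * δ)) (Finset.Ico k₀ k₁) H H x y +
      twoPoint P X e N q γ (γ * (1 + 3 * δ)) (Finset.Ico k₀ k₁) h h x y := fun x hx y hy => by
    refine (hFF x hx y hy).2.le.trans (sub_le_self _ (add_nonneg twoPoint_nonneg twoPoint_nonneg))
  obtain ⟨hRint, hsq⟩ := sq_integral_abs_integral_le (μ := μ.restrict S) (P := P)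
    (c := Real.exp (γ ^ 2 * ((1 + δ) * (1 / (H + H)) + K)) +
      Real.exp (γ ^ 2 * ((1 + δ) * (1 / (h + h)) + K))) hm
    (by
      filter_upwards [ae_restrict_mem hS] with x hx
      simpa only [sq] using (hFF x hx x hx).1)
    (by
      filter_upwards [ae_restrict_mem hS] with x hx
      simp_rw [sq (F x _)]
      exact (hcov x hx x hx).trans (add_le_add
        (hX.twoPoint_le hF hs (hSκ x hx) (hSκ x hx) hH hH)
        (hX.twoPoint_le hF hs (hSκ x hx) (hSκ x hx) hh hh)))
  have hEq : ∫ ω, |∫ x in S, wickExp P (γ • X H x) ω *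
        barrier X e N q (γ * (1 + 3 * δ)) (Finset.Ico k₀ k₁) x ω ∂μ -
      ∫ x in S, wickExp P (γ • X h x) ω *
        barrier X e N q (γ * (1 + 3 * δ)) (Finset.Ico k₀ k₁) x ω ∂μ| ∂P =
      ∫ ω, |∫ x in S, F x ω ∂μ| ∂P := by
    refine integral_congr_ae ?_
    filter_upwards [i1.prod_left_ae, i2.prod_left_ae] with ω h1 h2
    simp only [hFdef, sub_mul]
    simp only [Function.uncurry_apply_pair] at h1 h2
    rw [integral_sub h1 h2]
  rw [hEq]
  refine hsq.trans (integral_prod_le_of_near_far hS hSfin hRint (by positivity) (by positivity)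
    hFint ?_ ?_)
  · intro x hx y hy hxy
    obtain ⟨R, hR⟩ := hfar x hx y hy hxy
    simp only
    rw [(hFF x hx y hy).2]
    have h1 := abs_le.1 (hR H (by simp) H (by simp))
    have h2 := abs_le.1 (hR h (by simp) h (by simp))
    have h3 := abs_le.1 (hR H (by simp) h (by simp))
    have h4 := abs_le.1 (hR h (by simp) H (by simp))
    linarith [h1.2, h2.2, h3.1, h4.1]
  · intro x hx y hy hxy hlt
    refine (hcov x hx y hy).trans ?_
    have h1 := hX.twoPoint_near_le hF (hSκ x hx) (hSκ y hy) hγ hH hxy hlt hk₁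
    have h2 := hX.twoPoint_near_le hF (hSκ x hx) (hSκ y hy) hγ hh hxy hlt hk₁'
    linarith

end Mass

end IsLogField

lemma integral_abs_sub_le_add_add {Ω : Type*} [MeasurableSpace Ω] {P : Measure Ω}
    {f f' u u' : Ω → ℝ} (hf : Integrable f P) (hf' : Integrable f' P) (hu : Integrable u P)
    (hu' : Integrable u' P) :
    ∫ ω, |f ω - f' ω| ∂P ≤
      ∫ ω, |f ω - u ω| ∂P + ∫ ω, |u ω - u' ω| ∂P + ∫ ω, |f' ω - u' ω| ∂P := by
  have h₁ : Integrable (fun ω => |f ω - u ω|) P := (hf.sub hu).abs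
  have h₂ : Integrable (fun ω => |u ω - u' ω|) P := (hu.sub hu').abs
  have h₃ : Integrable (fun ω => |f' ω - u' ω|) P := (hf'.sub hu').abs
  have h₁₂ : Integrable (fun ω => |f ω - u ω| + |u ω - u' ω|) P := h₁.add h₂
  rw [← integral_add h₁ h₂, ← integral_add h₁₂ h₃]
  refine integral_mono (hf.sub hf').abs (h₁₂.add h₃) fun ω => ?_
  have h := (abs_sub_le (f ω) (u ω) (f' ω)).trans
    (add_le_add_right (abs_sub_le (u ω) (u' ω) (f' ω)) _)
  rw [abs_sub_comm (u' ω), ← add_assoc] at h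
  exact h

namespace IsLogField

section Cauchy

variable {Ω E : Type*} [MeasurableSpace Ω] [NormedAddCommGroup E] [NormedSpace ℝ E]
  [FiniteDimensional ℝ E] [MeasurableSpace E] [BorelSpace E] [Nontrivial E] {P : Measure Ω}
  [IsProbabilityMeasure P] {μ : Measure E} [μ.IsAddHaarMeasure] {S A D : Set E} {X : ℝ → E → Ω → ℝ}
  {g : E → E → ℝ} {η δ K γ κ ε : ℝ}

lemma exists_integral_abs_sub_le_of_ball_subset (hX : IsLogField P D X g η δ K)
    (hXm : ∀ H, Measurable (Function.uncurry (X H))) (hS : MeasurableSet S) (hSfin : μ S ≠ ⊤)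
    (hκ : 0 < κ) (hSκ : ∀ x ∈ S, Metric.ball x κ ⊆ D) (hγ : 0 < γ)
    (hγd : γ ^ 2 * (1 / 2 + 9 * δ) < Module.finrank ℝ E) (hε : 0 < ε) :
    ∃ H₁ ∈ Ioo 0 η, ∀ H ∈ Ioc 0 H₁, ∀ h ∈ Ioc 0 H₁,
      ∫ ω, |∫ x in S, wickExp P (γ • X H x) ω ∂μ - ∫ x in S, wickExp P (γ • X h x) ω ∂μ| ∂P ≤ ε := by
  have hδ := hX.delta_pos
  set m := μ.real S with hm
  have hm0 : 0 ≤ m := measureReal_nonneg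
  set r := Real.exp (-(γ * δ) ^ 2) with hr
  have hr1 : r < 1 := Real.exp_lt_one_iff.2 (neg_neg_of_pos (by positivity))
  have hsum : Summable fun k : ℕ => r ^ k := summable_geometric_of_lt_one (Real.exp_pos _).le hr1
  set B := Real.exp (γ ^ 2 * δ * (2 * (K + 12))) with hB
  set c := 2 * Real.exp (γ ^ 2 * (4 * K + 13) + γ) with hc
  obtain ⟨a, ha, hab⟩ := exists_pos_mul_lt (show 0 < ε / 4 by positivity) (m * B)
  obtain ⟨n, hn⟩ := exists_sum_le_of_summable hsum ha
  obtain ⟨ν, hν, hνb⟩ := exists_pos_mul_lt (show 0 < (ε / 2) ^ 2 / 2 by positivity) (m * c)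
  obtain ⟨ρ, hρ, hnear⟩ := exists_setIntegral_norm_rpow_neg_le μ hγd hν
  obtain ⟨τ, hτ, hτb⟩ := exists_pos_mul_lt (show 0 < (ε / 2) ^ 2 / 2 by positivity) (m * m * 4)
  obtain ⟨k₀, ⟨hk₀n, hk₀ρ⟩, hk₀κ⟩ : ∃ k₀ : ℕ, (n ≤ k₀ ∧ Real.exp (-k₀) ≤ ρ) ∧ Real.exp (-k₀) ≤ κ := by
    have hlim : Tendsto (fun k : ℕ => Real.exp (-k)) atTop (nhds 0) :=
      Real.tendsto_exp_neg_atTop_nhds_zero.comp tendsto_natCast_atTop_atTop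
    exact (((eventually_ge_atTop n).and (hlim.eventually (eventually_le_nhds hρ))).and
      (hlim.eventually (eventually_le_nhds hκ))).exists
  set T := Real.exp (γ ^ 2 * (2 * k₀ + K) + γ ^ 2 * δ * (2 * (K + 12) + (2 * (k₀ + 1) + K))) with hT
  obtain ⟨b, hb, hbT⟩ := exists_pos_mul_lt (show 0 < τ / 2 by positivity) (2 * T)
  obtain ⟨k₁, hk₁⟩ := exists_sum_le_of_summable hsum hb
  obtain ⟨η', hη', hR⟩ := hX.exists_abs_twoPoint_sub_le hγ (γ * (1 + 3 * δ)) k₀ k₁ (half_pos hτ)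
  obtain ⟨e₀, he₀⟩ := exists_norm_eq E zero_le_one
  obtain ⟨N, q, hF, hq⟩ := exists_isProbeFamily he₀ hX.pos hδ hκ hη' hk₀κ
  refine ⟨min η' η / 2, ⟨by have := hX.pos; positivity, ?_⟩, fun H hH h hh => ?_⟩
  · linarith [min_le_right η' η, lt_min hη' hX.pos]
  have hlt : min η' η / 2 < min η' η := half_lt_self (lt_min hη' hX.pos)
  have hmem : ∀ H ∈ Ioc 0 (min η' η / 2), H ∈ Ioo 0 η ∧ H < η' := fun H hH =>
    ⟨⟨hH.1, (hH.2.trans_lt hlt).trans_le (min_le_right _ _)⟩,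
      (hH.2.trans_lt hlt).trans_le (min_le_left _ _)⟩
  set k₂ := max k₁ (max (⌈1 / H⌉₊ + 1) (⌈1 / h⌉₊ + 1)) with hk₂
  have hs : ∀ k ∈ Finset.Ico k₀ k₂, k₀ ≤ k := fun k hk => (Finset.mem_Ico.1 hk).1
  have hbad : ∀ H ∈ Ioo 0 η, ∫ ω, |∫ x in S, wickExp P (γ • X H x) ω ∂μ -
      ∫ x in S, wickExp P (γ • X H x) ω *
        barrier X e₀ N q (γ * (1 + 3 * δ)) (Finset.Ico k₀ k₂) x ω ∂μ| ∂P ≤ ε / 4 := fun H hH => by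
    refine (hX.integral_abs_sub_barrier_le hXm hF hs hS hSfin hSκ hγ hH).trans ?_
    have := hn (Finset.Ico k₀ k₂) fun k hk => hk₀n.trans (hs k hk)
    calc m * (B * ∑ k ∈ Finset.Ico k₀ k₂, r ^ k) = m * B * ∑ k ∈ Finset.Ico k₀ k₂, r ^ k := by ring
      _ ≤ m * B * a := by gcongr
      _ ≤ ε / 4 := hab.le
  have hgood := hX.sq_integral_abs_barrier_sub_le (b := τ) hXm hF hS hSfin hSκ hγ (hmem H hH).1
    (hmem h hh).1 (k₁ := k₂) ((le_max_left _ _).trans (le_max_right _ _))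
    ((le_max_right _ _).trans (le_max_right _ _)) hτ.le (hnear _ hk₀ρ).1 (fun x hx y hy hxy => by
      obtain ⟨R, hR⟩ := hR e₀ N q κ hF hq x y (hSκ x hx) (hSκ y hy) hxy
      have hmem' : ∀ H' ∈ ({H, h} : Set ℝ), H' ∈ Ioo 0 η ∧ H' < η' := by
        rintro H' (rfl | rfl)
        exacts [hmem _ hH, hmem _ hh]
      refine ⟨R, fun H' hH' h' hh' => ?_⟩
      have h1 := hR H' (hmem' H' hH').1 h' (hmem' h' hh').1 (hmem' H' hH').2 (hmem' h' hh').2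
      have h2 := hX.abs_twoPoint_sub_le hF hs
        (Finset.Ico_subset_Ico_right (a := k₀) (le_max_left k₁ _)) (hSκ x hx) (hSκ y hy) hγ
        (hmem' H' hH').1 (hmem' h' hh').1 hxy
      have h3 := hk₁ (Finset.Ico k₀ k₂ \ Finset.Ico k₀ k₁) fun k hk => by
        simp only [Finset.mem_sdiff, Finset.mem_Ico] at hk
        omega
      have h4 : 2 * (T * ∑ k ∈ Finset.Ico k₀ k₂ \ Finset.Ico k₀ k₁, r ^ k) ≤ τ / 2 := by
        calc 2 * (T * ∑ k ∈ Finset.Ico k₀ k₂ \ Finset.Ico k₀ k₁, r ^ k) =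
              2 * T * ∑ k ∈ Finset.Ico k₀ k₂ \ Finset.Ico k₀ k₁, r ^ k := by ring
          _ ≤ 2 * T * b := by gcongr
          _ ≤ τ / 2 := hbT.le
      refine (abs_sub_le _ _ _).trans ((add_le_add (h2.trans h4) h1).trans (add_halves τ).le))
  have hgood' : ∫ ω, |∫ x in S, wickExp P (γ • X H x) ω *
        barrier X e₀ N q (γ * (1 + 3 * δ)) (Finset.Ico k₀ k₂) x ω ∂μ -
      ∫ x in S, wickExp P (γ • X h x) ω *
        barrier X e₀ N q (γ * (1 + 3 * δ)) (Finset.Ico k₀ k₂) x ω ∂μ| ∂P ≤ ε / 2 := by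
    refine le_of_sq_le_sq (hgood.trans ?_) (by positivity)
    have h1 := (hnear _ hk₀ρ).2
    have h2 : m * c * ∫ z in Metric.ball (0 : E) (Real.exp (-k₀)),
        ‖z‖ ^ (-(γ ^ 2 * (1 / 2 + 9 * δ))) ∂μ ≤ m * c * ν := by gcongr
    linear_combination h2 + hνb + hτb
  have hSD : S ⊆ D := fun x hx => hSκ x hx (Metric.mem_ball_self hκ)
  have i1 : ∀ H ∈ Ioo 0 η, Integrable (fun ω => ∫ x in S, wickExp P (γ • X H x) ω ∂μ) P :=
    fun H hH => (hX.integrable_prod_wickExp hXm hS hSfin hSD hH).integral_prod_right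
  have i2 : ∀ H ∈ Ioo 0 η, Integrable (fun ω => ∫ x in S, wickExp P (γ • X H x) ω *
      barrier X e₀ N q (γ * (1 + 3 * δ)) (Finset.Ico k₀ k₂) x ω ∂μ) P :=
    fun H hH => (hX.integrable_prod_wickExp_mul_barrier hXm hS hSfin hSD hH).integral_prod_right
  have hH' := (hmem H hH).1
  have hh' := (hmem h hh).1
  have h1 := hbad H hH'
  have h2 := hbad h hh'
  refine (integral_abs_sub_le_add_add (i1 H hH') (i1 h hh') (i2 H hH') (i2 h hh')).trans ?_
  linarith

lemma exists_integral_abs_sub_le (hX : IsLogField P D X g η δ K)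
    (hXm : ∀ H, Measurable (Function.uncurry (X H))) (hD : IsOpen D) (hA : MeasurableSet A)
    (hAD : A ⊆ D) (hAfin : μ A ≠ ⊤) (hγ : 0 < γ)
    (hγd : γ ^ 2 * (1 / 2 + 9 * δ) < Module.finrank ℝ E) (hε : 0 < ε) :
    ∃ H₁ ∈ Ioo 0 η, ∀ H ∈ Ioc 0 H₁, ∀ h ∈ Ioc 0 H₁,
      ∫ ω, |∫ x in A, wickExp P (γ • X H x) ω ∂μ - ∫ x in A, wickExp P (γ • X h x) ω ∂μ| ∂P ≤ ε := by
  have hAfin' : IsFiniteMeasure (μ.restrict A) := ⟨by simpa using hAfin.lt_top⟩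
  have hlim := tendsto_measure_thickening_of_isClosed (μ := μ.restrict A) (s := Dᶜ)
    ⟨1, zero_lt_one, measure_ne_top _ _⟩ hD.isClosed_compl
  have hzero : μ.restrict A Dᶜ = 0 := by
    rw [Measure.restrict_apply hD.measurableSet.compl,
      (disjoint_compl_left_iff_subset.2 hAD).inter_eq, measure_empty]
  rw [hzero] at hlim
  obtain ⟨κ, hκle, hκ⟩ := ((hlim.eventually (eventually_le_nhds
    (ENNReal.ofReal_pos.2 (show 0 < ε / 3 by positivity)))).and self_mem_nhdsWithin).exists
  rw [Measure.restrict_apply Metric.isOpen_thickening.measurableSet] at hκle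
  set S := A \ Metric.thickening κ Dᶜ with hSdef
  have hSA : S ⊆ A := sdiff_subset
  have hS : MeasurableSet S := hA.diff Metric.isOpen_thickening.measurableSet
  have hSfin : μ S ≠ ⊤ := measure_ne_top_of_subset hSA hAfin
  have hSκ : ∀ x ∈ S, Metric.ball x κ ⊆ D := fun x hx z hz => by
    by_contra hzD
    exact hx.2 (Metric.mem_thickening_iff.2 ⟨z, hzD, by rwa [dist_comm]⟩)
  have hdiff : μ.real (A \ S) ≤ ε / 3 := by
    rw [hSdef, sdiff_sdiff_right_self, inter_comm]
    exact ENNReal.toReal_le_of_le_ofReal (by positivity) hκle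
  obtain ⟨H₁, hH₁, hS₁⟩ := hX.exists_integral_abs_sub_le_of_ball_subset (μ := μ) hXm hS hSfin hκ hSκ
    hγ hγd (show 0 < ε / 3 by positivity)
  refine ⟨H₁, hH₁, fun H hH h hh => ?_⟩
  have hmem : ∀ H ∈ Ioc 0 H₁, H ∈ Ioo 0 η := fun H hH => ⟨hH.1, hH.2.trans_lt hH₁.2⟩
  have happrox : ∀ H ∈ Ioo 0 η, ∫ ω, |∫ x in A, wickExp P (γ • X H x) ω ∂μ -
      ∫ x in S, wickExp P (γ • X H x) ω ∂μ| ∂P ≤ ε / 3 := fun H hH => by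
    have : IsFiniteMeasure (μ.restrict (A \ S)) :=
      ⟨by simpa using (measure_ne_top_of_subset sdiff_subset hAfin).lt_top⟩
    have hbound := integral_abs_integral_le (μ := μ.restrict (A \ S)) (P := P) (c := 1)
      (measurable_uncurry_wickExp_smul (hXm H) γ)
      (by
        filter_upwards [ae_restrict_mem (hA.diff hS)] with x hx
        exact hX.gaussian.integrable_wickExp (smul_mem_fieldSpan hH (hAD hx.1)))
      (by
        filter_upwards [ae_restrict_mem (hA.diff hS)] with x hx
        simp_rw [abs_of_pos (wickExp_pos _ _)]
        exact (hX.gaussian.integral_wickExp (smul_mem_fieldSpan hH (hAD hx.1))).le)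
    rw [measureReal_restrict_apply_univ, mul_one] at hbound
    refine (le_of_eq (integral_congr_ae ?_)).trans (hbound.trans hdiff)
    filter_upwards [(hX.integrable_prod_wickExp (γ := γ) (μ := μ) hXm hA hAfin hAD hH).prod_left_ae]
      with ω hω
    simp only [Function.uncurry_apply_pair] at hω
    rw [setIntegral_sdiff hS hω hSA]
  have i1 := fun H hH =>
    (hX.integrable_prod_wickExp (γ := γ) (H := H) hXm hA hAfin hAD hH).integral_prod_right
  have i2 := fun H hH => (hX.integrable_prod_wickExp (γ := γ) (H := H) hXm hS hSfin
    (hSA.trans hAD) hH).integral_prod_right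
  have h1 := happrox H (hmem H hH)
  have h2 := happrox h (hmem h hh)
  have h3 := hS₁ H hH h hh
  refine (integral_abs_sub_le_add_add (i1 H (hmem H hH)) (i1 h (hmem h hh)) (i2 H (hmem H hH))
    (i2 h (hmem h hh))).trans ?_
  simp only [Function.uncurry_apply_pair]
  linarith

end Cauchy

end IsLogField

lemma exists_tendsto_integral_abs_sub {Ω ι : Type*} [MeasurableSpace Ω] {P : Measure Ω}
    {l : Filter ι} [l.NeBot] {M : ι → Ω → ℝ} (hm : ∀ i, AEStronglyMeasurable (M i) P)
    (hFint : ∀ᶠ i in l, Integrable (M i) P)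
    (hM : ∀ ε > 0, ∀ᶠ z in l ×ˢ l, ∫ ω, |M z.1 ω - M z.2 ω| ∂P ≤ ε) :
    ∃ Mlim : Ω → ℝ, Tendsto (fun i => ∫ ω, |M i ω - Mlim ω| ∂P) l (nhds 0) ∧
      TendstoInMeasure P M l Mlim := by
  classical
  set f : ι → Ω →₁[P] ℝ := fun i => if h : Integrable (M i) P then h.toL1 (M i) else 0 with hf
  have hdist : ∀ i, Integrable (M i) P → ∀ u : Ω →₁[P] ℝ, dist (f i) u = ∫ ω, |M i ω - u ω| ∂P := by
    intro i hi u
    rw [hf]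
    simp only [dif_pos hi]
    rw [dist_eq_norm, L1.norm_eq_integral_norm]
    refine integral_congr_ae ?_
    filter_upwards [Lp.coeFn_sub (hi.toL1 (M i)) u, hi.coeFn_toL1] with ω h1 h2
    rw [h1, Pi.sub_apply, h2, Real.norm_eq_abs]
  have hdist' : ∀ i j, Integrable (M i) P → Integrable (M j) P →
      dist (f i) (f j) = ∫ ω, |M i ω - M j ω| ∂P := by
    intro i j hi hj
    rw [hdist i hi]
    refine integral_congr_ae ?_
    have hfj : f j = hj.toL1 (M j) := dif_pos hj
    filter_upwards [hj.coeFn_toL1] with ω h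
    rw [hfj, h]
  have hC : Cauchy (map f l) := by
    refine ⟨inferInstance, ?_⟩
    rw [prod_map_map_eq, Metric.uniformity_basis_dist.ge_iff]
    intro ε hε
    rw [mem_map]
    filter_upwards [hM _ (half_pos hε), (hFint.prod_mk hFint)] with z hz hz'
    simp only [mem_preimage, mem_ofPred_eq]
    rw [hdist' _ _ hz'.1 hz'.2]
    linarith
  obtain ⟨u, hu⟩ := CompleteSpace.complete hC
  have hu' : Tendsto f l (nhds u) := hu
  have hlim : Tendsto (fun i => ∫ ω, |M i ω - u ω| ∂P) l (nhds 0) := by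
    refine (tendsto_iff_dist_tendsto_zero.1 hu').congr' ?_
    filter_upwards [hFint] with i hi using hdist i hi u
  refine ⟨u, hlim, tendstoInMeasure_of_tendsto_eLpNorm one_ne_zero hm
    (Lp.aestronglyMeasurable u) ?_⟩
  have h0 : Tendsto (fun i => ENNReal.ofReal (∫ ω, |M i ω - u ω| ∂P)) l (nhds 0) := by
    simpa using ENNReal.tendsto_ofReal hlim
  refine h0.congr' ?_
  filter_upwards [hFint] with i hi
  rw [eLpNorm_one_eq_lintegral_enorm]
  exact ofReal_integral_norm_eq_lintegral_enorm (hi.sub (L1.integrable_coeFn u))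

theorem stmt_12
    {d : ℕ} (hd : 1 ≤ d)
    {Ω : Type} [MeasurableSpace Ω] (P : Measure Ω) [IsProbabilityMeasure P]
    (D : Set (EuclideanSpace ℝ (Fin d)))
    (hDopen : IsOpen D) (hDconn : IsConnected D) (hDbdd : Bornology.IsBounded D)
    (H₀ : ℝ) (hH₀ : H₀ ∈ Set.Ioo (0 : ℝ) (1/2))
    (X : ℝ → EuclideanSpace ℝ (Fin d) → Ω → ℝ)
    (hXmeas : Measurable fun p : ℝ × EuclideanSpace ℝ (Fin d) × Ω => X p.1 p.2.1 p.2.2)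
    (C : ℝ → ℝ → ℝ) (G : ℝ → ℝ → EuclideanSpace ℝ (Fin d) → EuclideanSpace ℝ (Fin d) → ℝ)
    (g : EuclideanSpace ℝ (Fin d) → EuclideanSpace ℝ (Fin d) → ℝ)
    (hCpos : ∀ H h : ℝ, H ∈ Set.Ioo 0 H₀ → h ∈ Set.Ioo 0 H₀ → 0 < C H h)
    (hGbdd : ∀ H h : ℝ, H ∈ Set.Ioo 0 H₀ → h ∈ Set.Ioo 0 H₀ →
      ∃ K : ℝ, ∀ x ∈ D, ∀ y ∈ D, |G H h x y| ≤ K)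
    (hgauss : ∀ (n : ℕ) (c : Fin n → ℝ) (Hs : Fin n → ℝ) (xs : Fin n → EuclideanSpace ℝ (Fin d)),
      (∀ i, Hs i ∈ Set.Ioo 0 H₀) → (∀ i, xs i ∈ D) →
      ∃ v : NNReal, P.map (fun ω => ∑ i, c i * X (Hs i) (xs i) ω) = gaussianReal 0 v)
    (hcov : ∀ H h : ℝ, H ∈ Set.Ioo 0 H₀ → h ∈ Set.Ioo 0 H₀ → ∀ x ∈ D, ∀ y ∈ D,
      ∫ ω, X H x ω * X h y ω ∂P =
        C H h * ((1 - ‖x - y‖ ^ (H + h)) / (H + h) + G H h x y))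
    (hA1 : ∀ ε > (0 : ℝ), ∃ η > (0 : ℝ), ∀ H h : ℝ,
      H ∈ Set.Ioo 0 (min η H₀) → h ∈ Set.Ioo 0 (min η H₀) → |C H h - 1| ≤ ε)
    (hgbdd : ∃ K : ℝ, ∀ x ∈ D, ∀ y ∈ D, |g x y| ≤ K)
    (hA2 : ∀ ε > (0 : ℝ), ∃ η > (0 : ℝ), ∀ H h : ℝ,
      H ∈ Set.Ioo 0 (min η H₀) → h ∈ Set.Ioo 0 (min η H₀) →
      ∀ x ∈ D, ∀ y ∈ D, |G H h x y - g x y| ≤ ε)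
    :
    ∃ γstar : ℝ, γstar > Real.sqrt (7 * d / 4) ∧
      ∀ γ ∈ Set.Ioc (0 : ℝ) γstar,
        ∀ (A : Set (EuclideanSpace ℝ (Fin d))), A ⊆ D → MeasurableSet A →
          ∀ M : ℝ → Ω → ℝ,
            (∀ H ω, M H ω = ∫ x in A, Real.exp (γ * X H x ω -
              γ ^ 2 / 2 * ∫ ω', (X H x ω') ^ 2 ∂P)) →
            (∀ ε > (0 : ℝ), ∃ H₁ ∈ Set.Ioo (0 : ℝ) H₀,
              ∀ H ∈ Set.Ioc (0 : ℝ) H₁, ∀ H' ∈ Set.Ioc (0 : ℝ) H₁,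
                (∫ ω, |M H ω - M H' ω| ∂P) ≤ ε) ∧
            ∃ Mlim : Ω → ℝ,
              Tendsto (fun H => ∫ ω, |M H ω - Mlim ω| ∂P)
                (nhdsWithin 0 (Set.Ioo 0 H₀)) (nhds 0) ∧
              TendstoInMeasure P (fun H => M H) (nhdsWithin 0 (Set.Ioo 0 H₀)) Mlim := by
  have hXjoint : ∀ H, Measurable (Function.uncurry (X H)) := fun H =>
    hXmeas.comp (measurable_const.prodMk measurable_id)
  have hXm : ∀ H x, Measurable (X H x) := fun H x => (hXjoint H).comp measurable_prodMk_left
  obtain ⟨η, K, hη₀, hX⟩ := isLogField_of_cov (δ := 1 / 400) hDbdd hH₀ hXm hgauss hcov hA1 hgbdd hA2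
    (by norm_num) (by norm_num)
  have hd0 : (0 : ℝ) < d := by exact_mod_cast hd
  have : Nonempty (Fin d) := ⟨⟨0, hd⟩⟩
  refine ⟨Real.sqrt (9 * d / 5), Real.sqrt_lt_sqrt (by positivity) (by linarith),
    fun γ hγ A hAD hA M hM => ?_⟩
  have hγsq : γ ^ 2 ≤ 9 * d / 5 := (Real.le_sqrt' hγ.1).1 hγ.2
  have hγd : γ ^ 2 * (1 / 2 + 9 * (1 / 400)) < Module.finrank ℝ (EuclideanSpace ℝ (Fin d)) := by
    rw [finrank_euclideanSpace_fin]
    linarith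
  have hAfin : volume A ≠ ⊤ := (hDbdd.subset hAD).measure_lt_top.ne
  have hMw : M = fun H ω => ∫ x in A, wickExp P (γ • X H x) ω := by
    funext H ω
    rw [hM]
    refine integral_congr_ae (ae_of_all _ fun x => ?_)
    simp only [wickExp, IsCenteredGaussianSpace.integral_smul_mul_smul, ← sq (X H x _)]
    rw [Pi.smul_apply, smul_eq_mul]
    congr 1
    ring
  have hcauchy : ∀ ε > (0 : ℝ), ∃ H₁ ∈ Set.Ioo (0 : ℝ) H₀, ∀ H ∈ Set.Ioc (0 : ℝ) H₁,
      ∀ H' ∈ Set.Ioc (0 : ℝ) H₁, (∫ ω, |M H ω - M H' ω| ∂P) ≤ ε := fun ε hε => by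
    obtain ⟨H₁, hH₁, h⟩ := hX.exists_integral_abs_sub_le (μ := volume) hXjoint hDopen hA hAD hAfin
      hγ.1 hγd hε
    rw [hMw]
    exact ⟨H₁, ⟨hH₁.1, hH₁.2.trans_le hη₀⟩, h⟩
  refine ⟨hcauchy, ?_⟩
  rw [nhdsWithin_Ioo_eq_nhdsGT hH₀.1]
  refine exists_tendsto_integral_abs_sub (fun H => ?_) ?_ fun ε hε => ?_
  · rw [hMw]
    exact (measurable_uncurry_wickExp_smul (hXjoint H) γ).stronglyMeasurable.integral_prod_left
      |>.aestronglyMeasurable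
  · filter_upwards [Ioo_mem_nhdsGT hX.pos] with H hH
    rw [hMw]
    exact (hX.integrable_prod_wickExp hXjoint hA hAfin hAD hH).integral_prod_right
  · obtain ⟨H₁, hH₁, h⟩ := hcauchy ε hε
    have hmem := Ioc_mem_nhdsGT hH₁.1
    filter_upwards [prod_mem_prod hmem hmem] with z hz using h _ hz.1 _ hz.2
end

section
/- For every real h with 0 < h ≤ 1 and every real r > 0: 0 ≤ log(1/r) − (1 − r^h)/h; moreover log(1/r) − (1 − r^h)/h ≤ (h/2) (log r)² if 0 < r ≤ 1, and log(1/r) − (1 − r^h)/h ≤ h(r − 1 − log r) if r > 1. -/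
theorem Real.exp_le_one_add_add_sq_div_two {x : ℝ} (hx : x ≤ 0) :
    Real.exp x ≤ 1 + x + x ^ 2 / 2 := by
  have hd (y : ℝ) : HasDerivAt (fun y : ℝ => 1 + y + y ^ 2 / 2 - Real.exp y)
      (1 + y - Real.exp y) y := by
    refine ((((hasDerivAt_id y).const_add 1).add
      (((hasDerivAt_id y).pow 2).div_const 2)).sub (Real.hasDerivAt_exp y)).congr_deriv ?_
    simp
  have hanti : Antitone (fun y : ℝ => 1 + y + y ^ 2 / 2 - Real.exp y) :=
    antitone_of_hasDerivAt_nonpos hd fun y => by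
      have := Real.add_one_le_exp y
      simp only [Pi.zero_apply]
      linarith
  have := hanti hx
  norm_num at this
  linarith

theorem Real.exp_mul_le_of_mem_Icc {h : ℝ} (h0 : 0 ≤ h) (h1 : h ≤ 1) (x : ℝ) :
    Real.exp (h * x) ≤ h * Real.exp x + (1 - h) := by
  simpa using convexOn_exp.2 (Set.mem_univ x) (Set.mem_univ 0) h0 (sub_nonneg.2 h1)
    (add_sub_cancel h 1)

theorem Real.exp_mul_sub_one_sub_le {h x : ℝ} (h0 : 0 ≤ h) (h1 : h ≤ 1) (hx : 0 ≤ x) :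
    Real.exp (h * x) - 1 - h * x ≤ h ^ 2 * (Real.exp x - 1 - x) := by
  have hd (y : ℝ) : HasDerivAt
      (fun y : ℝ => h ^ 2 * (Real.exp y - 1 - y) - (Real.exp (h * y) - 1 - h * y))
      (h * (h * Real.exp y + (1 - h) - Real.exp (h * y))) y := by
    have hm : HasDerivAt (fun y : ℝ => h * y) h y := by
      simpa using (hasDerivAt_id y).const_mul h
    refine (((((Real.hasDerivAt_exp y).sub_const 1).sub (hasDerivAt_id y)).const_mul
      (h ^ 2)).sub ((hm.exp.sub_const 1).sub hm)).congr_deriv ?_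
    ring
  have hmono : Monotone
      (fun y : ℝ => h ^ 2 * (Real.exp y - 1 - y) - (Real.exp (h * y) - 1 - h * y)) :=
    monotone_of_hasDerivAt_nonneg hd fun y =>
      mul_nonneg h0 (sub_nonneg.2 (Real.exp_mul_le_of_mem_Icc h0 h1 y))
  have := hmono hx
  norm_num at this
  linarith

theorem stmt_19 (h r : ℝ) (hh : 0 < h) (hh1 : h ≤ 1) (hr : 0 < r) :
    0 ≤ Real.log (1 / r) - (1 - r ^ h) / h ∧
    (r ≤ 1 → Real.log (1 / r) - (1 - r ^ h) / h ≤ h / 2 * Real.log r ^ 2) ∧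
    (1 < r → Real.log (1 / r) - (1 - r ^ h) / h ≤ h * (r - 1 - Real.log r)) := by
  have key : Real.log (1 / r) - (1 - r ^ h) / h =
      (Real.exp (h * Real.log r) - 1 - h * Real.log r) / h := by
    rw [Real.rpow_def_of_pos hr, mul_comm (Real.log r) h, one_div, Real.log_inv]
    field_simp
    ring
  rw [key]
  refine ⟨?_, fun hr1 => ?_, fun hr1 => ?_⟩
  · refine div_nonneg ?_ hh.le
    linarith [Real.add_one_le_exp (h * Real.log r)]
  · rw [div_le_iff₀ hh]
    have := Real.exp_le_one_add_add_sq_div_two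
      (mul_nonpos_of_nonneg_of_nonpos hh.le (Real.log_nonpos hr.le hr1))
    linarith
  · rw [div_le_iff₀ hh]
    have := Real.exp_mul_sub_one_sub_le hh.le hh1 (Real.log_nonneg hr1.le)
    rw [Real.exp_log hr] at this
    linarith
end
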